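/- arXiv:2010.05018 — 8 statements merged into one kernel-verified Lean document; each statement's English description precedes it below -/
import Mathlib

section
/- The function H(q) = T(q) − log(1−q)/log(q) is positive and strictly increasing on the open interval (0,1). -/
/-- `d k = ` number of positive divisors of `k` -/
noncomputable def numDivisors (k : ℕ) : ℕ := k.divisors.card

/-- `T q = ∑_{k=1}^∞ d(k) q^k` (the `k = 0` term vanishes since `d 0 = 0`). -/
noncomputable def T (q : ℝ) : ℝ := ∑' k : ℕ, (numDivisors k : ℝ) * q ^ k

/-- `H q = T q - log(1-q)/log q`. -/
noncomputable def H (q : ℝ) : ℝ := T q - Real.log (1 - q) / Real.log q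

open Real Set

lemma one_sub_one_div_add_exp_pos {s : ℝ} (hs : 1 < s) :
    0 < s - 1 / s - 1 + exp (1 - s ^ 2) := by
  have hmono : StrictMonoOn (fun s : ℝ ↦ s - 1 / s - 1 + exp (1 - s ^ 2)) (Ici 1) := by
    have hd (x : ℝ) (hx : 1 ≤ x) : HasDerivAt (fun s : ℝ ↦ s - 1 / s - 1 + exp (1 - s ^ 2))
        (1 + 1 / x ^ 2 - 2 * x * exp (1 - x ^ 2)) x := by
      have h0 : x ≠ 0 := by positivity
      have h := (((hasDerivAt_id' x).sub (hasDerivAt_inv h0)).sub_const 1).add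
        (((hasDerivAt_pow 2 x).const_sub 1).exp)
      refine (h.congr_deriv ?_).congr_of_eventuallyEq (.of_forall fun y ↦ ?_)
      · push_cast; ring
      · simp
    refine strictMonoOn_of_deriv_pos (convex_Ici 1)
      (fun x hx ↦ (hd x hx).continuousAt.continuousWithinAt) fun x hx ↦ ?_
    rw [interior_Ici, mem_Ioi] at hx
    rw [(hd x hx.le).deriv]
    have hx0 : 0 < x := by positivity
    have hle : exp (1 - x ^ 2) ≤ 1 / x ^ 2 := by
      rw [← neg_sub, exp_neg, ← one_div]
      exact one_div_le_one_div_of_le (by positivity) (by linarith [add_one_le_exp (x ^ 2 - 1)])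
    have hsq : 0 < (1 - 1 / x) ^ 2 := by
      have : 1 / x < 1 := (div_lt_one hx0).2 hx
      nlinarith
    have heq : (1 - 1 / x) ^ 2 = 1 + 1 / x ^ 2 - 2 * x * (1 / x ^ 2) := by
      field_simp; ring
    nlinarith [mul_le_mul_of_nonneg_left hle (by positivity : 0 ≤ 2 * x)]
  simpa using hmono self_mem_Ici hs.le hs

lemma one_add_mul_one_sub_exp_neg_sq_lt {x : ℝ} (hx : 0 < x) :
    (1 + x) * (1 - exp (-x)) ^ 2 < x ^ 2 := by
  have hs : 1 < √(1 + x) := by rw [lt_sqrt] <;> linarith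
  have hsq : √(1 + x) ^ 2 = 1 + x := sq_sqrt (by positivity)
  have hpos := one_sub_one_div_add_exp_pos hs
  set s := √(1 + x)
  have hx' : x = s ^ 2 - 1 := by linarith
  rw [show 1 - s ^ 2 = -x by linarith] at hpos
  have h0 : 0 < s := by positivity
  have hlt : s * (1 - exp (-x)) < x := by
    have : s * (s - 1 / s - 1 + exp (-x)) = x - s * (1 - exp (-x)) := by
      rw [hx']; field_simp; ring
    linarith [mul_pos h0 hpos]
  have hu : exp (-x) < 1 := exp_lt_one_iff.2 (by linarith)
  rw [← hsq, ← mul_pow]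
  exact pow_lt_pow_left₀ hlt (mul_nonneg h0.le (by linarith)) two_ne_zero

/-- The summand in the expansion `H (exp (-t)) = ∑ n ≥ 1, lambertGap (n * t)`. -/
noncomputable def lambertGap (x : ℝ) : ℝ := exp (-x) / (1 - exp (-x)) - exp (-x) / x

lemma lambertGap_pos {x : ℝ} (hx : 0 < x) : 0 < lambertGap x := by
  have hu : exp (-x) < 1 := exp_lt_one_iff.2 (by linarith)
  exact sub_pos.2 (div_lt_div_of_pos_left (exp_pos _) (by linarith)
    (by linarith [add_one_lt_exp (neg_ne_zero.2 hx.ne')]))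

lemma hasDerivAt_lambertGap {x : ℝ} (hx : 0 < x) :
    HasDerivAt lambertGap (exp (-x) * ((1 + x) / x ^ 2 - 1 / (1 - exp (-x)) ^ 2)) x := by
  have hu : 1 - exp (-x) ≠ 0 := by linarith [exp_lt_one_iff.2 (show -x < 0 by linarith)]
  have he : HasDerivAt (fun y : ℝ ↦ exp (-y)) (-exp (-x)) x := by
    simpa using (hasDerivAt_neg x).exp
  refine ((he.div (he.const_sub 1) hu).sub (he.div (hasDerivAt_id' x) hx.ne')).congr_deriv ?_
  field_simp
  ring

lemma strictAntiOn_lambertGap : StrictAntiOn lambertGap (Ioi 0) := by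
  refine strictAntiOn_of_deriv_neg (convex_Ioi 0)
    (fun x hx ↦ (hasDerivAt_lambertGap hx).continuousAt.continuousWithinAt) fun x hx ↦ ?_
  rw [interior_Ioi, mem_Ioi] at hx
  rw [(hasDerivAt_lambertGap hx).deriv]
  have hu : 0 < 1 - exp (-x) := by linarith [exp_lt_one_iff.2 (show -x < 0 by linarith)]
  refine mul_neg_of_pos_of_neg (exp_pos _) (sub_neg.2 ?_)
  rw [div_lt_div_iff₀ (by positivity) (by positivity), one_mul]
  exact one_add_mul_one_sub_exp_neg_sq_lt hx

lemma T_eq_tsum_lambert {q : ℝ} (hq : ‖q‖ < 1) :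
    T q = ∑' n : ℕ+, q ^ (n : ℕ) / (1 - q ^ (n : ℕ)) := by
  have h := tsum_pow_div_one_sub_eq_tsum_sigma hq 0
  simp only [pow_zero, one_mul] at h
  rw [h, T]
  simp only [ArithmeticFunction.sigma_zero_apply]
  exact (tsum_pnat_eq_tsum_of_eq_zero (f := fun n ↦ (numDivisors n : ℝ) * q ^ n)
    (by simp [numDivisors])).symm

lemma hasSum_lambertGap {q : ℝ} (hq : q ∈ Ioo (0 : ℝ) 1) :
    HasSum (fun n : ℕ+ ↦ lambertGap (n * -log q)) (H q) := by
  obtain ⟨h0, h1⟩ := hq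
  have hn : ‖q‖ < 1 := by rwa [norm_of_nonneg h0.le]
  have hT : HasSum (fun n : ℕ+ ↦ q ^ (n : ℕ) / (1 - q ^ (n : ℕ))) (T q) := by
    rw [T_eq_tsum_lambert hn]
    refine Summable.hasSum ?_
    have := summable_norm_pow_mul_geometric_div_one_sub 0 hn
    simp only [pow_zero, one_mul] at this
    exact this.comp_injective PNat.coe_injective
  have hL : HasSum (fun n : ℕ+ ↦ q ^ (n : ℕ) / (n : ℕ)) (-log (1 - q)) := by
    rw [hasSum_pnat_iff_hasSum_succ (f := fun n ↦ q ^ n / (n : ℝ))]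
    simpa using hasSum_pow_div_log_of_abs_lt_one (x := q) hn
  have hterm (n : ℕ+) : lambertGap (n * -log q) =
      q ^ (n : ℕ) / (1 - q ^ (n : ℕ)) - q ^ (n : ℕ) / (n : ℕ) / -log q := by
    have hexp : exp (-(n * -log q)) = q ^ (n : ℕ) := by
      rw [mul_neg, neg_neg, exp_nat_mul, exp_log h0]
    rw [lambertGap, hexp, div_div]
  rw [H, ← neg_div_neg_eq]
  simpa only [hterm] using hT.sub (hL.div_const (-log q))

/-- The function `H` is positive and strictly increasing on `(0,1)`. -/
theorem H_pos_and_strictMonoOn :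
    (∀ q ∈ Set.Ioo (0 : ℝ) 1, 0 < H q) ∧ StrictMonoOn H (Set.Ioo (0 : ℝ) 1) := by
  have harg {q : ℝ} (hq : q ∈ Ioo (0 : ℝ) 1) (n : ℕ+) : 0 < (n : ℝ) * -log q :=
    mul_pos (by exact_mod_cast n.pos) (neg_pos.2 (log_neg hq.1 hq.2))
  refine ⟨fun q hq ↦ ?_, fun p hp q hq hpq ↦ ?_⟩
  · exact hasSum_lt (i := (1 : ℕ+)) (fun n ↦ (lambertGap_pos (harg hq n)).le)
      (lambertGap_pos (harg hq 1)) hasSum_zero (hasSum_lambertGap hq)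
  · have hlt (n : ℕ+) : lambertGap (n * -log p) < lambertGap (n * -log q) :=
      strictAntiOn_lambertGap (harg hq n) (harg hp n)
        (mul_lt_mul_of_pos_left (neg_lt_neg (log_lt_log hp.1 hpq)) (by exact_mod_cast n.pos))
    exact hasSum_lt (i := (1 : ℕ+)) (fun n ↦ (hlt n).le) (hlt 1)
      (hasSum_lambertGap hp) (hasSum_lambertGap hq)
end

section
/- The function F(q) = ((1−q)/q)·(T(q) − log(1−q)/log(q)) is strictly decreasing on the open interval (0,1). -/
/-- `F q = ((1-q)/q) * (T q - log(1-q)/log q)`. -/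
noncomputable def F (q : ℝ) : ℝ := (1 - q) / q * (T q - Real.log (1 - q) / Real.log q)

open Filter Topology

namespace LambertMonotone

theorem pow_three_mul_cosh_le_sinh_pow_three {x : ℝ} (hx : 0 ≤ x) :
    x ^ 3 * Real.cosh x ≤ Real.sinh x ^ 3 := by
  have hw (y : ℝ) : 0 < Real.cosh y ^ (-(1 / 3) : ℝ) := Real.rpow_pos_of_pos (Real.cosh_pos y) _
  have hw3 (y : ℝ) : (Real.cosh y ^ (-(1 / 3) : ℝ)) ^ 3 * Real.cosh y = 1 := by
    rw [← Real.rpow_natCast, ← Real.rpow_mul (Real.cosh_pos y).le]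
    norm_num [Real.rpow_neg_one, (Real.cosh_pos y).ne']
  have hd (y : ℝ) : HasDerivAt
      (fun y => Real.sinh y * Real.cosh y ^ (-(1 / 3) : ℝ) - y)
      (Real.cosh y * Real.cosh y ^ (-(1 / 3) : ℝ) + Real.sinh y *
        (Real.sinh y * (-(1 / 3)) * Real.cosh y ^ (-(1 / 3) - 1 : ℝ)) - 1) y :=
    ((Real.hasDerivAt_sinh y).mul
      ((Real.hasDerivAt_cosh y).rpow_const (Or.inl (Real.cosh_pos y).ne'))).sub (hasDerivAt_id y)
  have hmono : Monotone (fun y => Real.sinh y * Real.cosh y ^ (-(1 / 3) : ℝ) - y) := by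
    refine monotone_of_deriv_nonneg (fun y => (hd y).differentiableAt) fun y => ?_
    rw [(hd y).deriv, Real.rpow_sub_one (Real.cosh_pos y).ne']
    have hC := Real.cosh_pos y
    have hSC := Real.cosh_sq y
    have h1 := hw y
    have h2 := hw3 y
    generalize Real.cosh y ^ (-(1 / 3) : ℝ) = w at *
    generalize Real.cosh y = C at *
    generalize Real.sinh y = S at *
    have key : 0 ≤ (2 * C ^ 2 + 1) * w - 3 * C := by
      have h5 : 0 < w ^ 5 := by positivity
      refine nonneg_of_mul_nonneg_left (b := w ^ 5) ?_ h5
      have : ((2 * C ^ 2 + 1) * w - 3 * C) * w ^ 5 = (w ^ 2 - 1) ^ 2 * (w ^ 2 + 2) := by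
        linear_combination (2 * (w ^ 3 * C + 1) - 3 * w ^ 2) * h2
      rw [this]; positivity
    have : C * w + S * (S * -(1 / 3) * (w / C)) - 1 = ((2 * C ^ 2 + 1) * w - 3 * C) / (3 * C) := by
      field_simp
      linear_combination w * hSC
    rw [this]; positivity
  have h0 : x ≤ Real.sinh x * Real.cosh x ^ (-(1 / 3) : ℝ) := by
    simpa using hmono hx
  calc x ^ 3 * Real.cosh x
      ≤ (Real.sinh x * Real.cosh x ^ (-(1 / 3) : ℝ)) ^ 3 * Real.cosh x := by
        have := (Real.cosh_pos x).le
        gcongr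
    _ = Real.sinh x ^ 3 := by rw [mul_pow, mul_assoc, hw3, mul_one]

/-- The Laplace-type weight `1/(1-e^{-y}) - 1/y`. -/
noncomputable def weight (y : ℝ) : ℝ := 1 / (1 - Real.exp (-y)) - 1 / y

/-- The derivative of `weight`. -/
noncomputable def weightDeriv (y : ℝ) : ℝ := 1 / y ^ 2 - Real.exp (-y) / (1 - Real.exp (-y)) ^ 2

theorem one_sub_exp_neg_pos {y : ℝ} (hy : 0 < y) : 0 < 1 - Real.exp (-y) := by
  simpa using hy

theorem hasDerivAt_one_sub_exp_neg (y : ℝ) :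
    HasDerivAt (fun y => 1 - Real.exp (-y)) (Real.exp (-y)) y := by
  simpa using ((hasDerivAt_neg y).exp).const_sub 1

theorem hasDerivAt_weight {y : ℝ} (hy : 0 < y) : HasDerivAt weight (weightDeriv y) y := by
  have hE := one_sub_exp_neg_pos hy
  refine (((hasDerivAt_const y (1 : ℝ)).div (hasDerivAt_one_sub_exp_neg y) hE.ne').sub
    ((hasDerivAt_const y (1 : ℝ)).div (hasDerivAt_id y) hy.ne')).congr_deriv ?_
  simp [weightDeriv]
  ring

theorem hasDerivAt_weightDeriv {y : ℝ} (hy : 0 < y) :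
    HasDerivAt weightDeriv
      (Real.exp (-y) * (1 + Real.exp (-y)) / (1 - Real.exp (-y)) ^ 3 - 2 / y ^ 3) y := by
  have hE := one_sub_exp_neg_pos hy
  refine (((hasDerivAt_const y (1 : ℝ)).div (hasDerivAt_pow 2 y) (by positivity)).sub
    ((hasDerivAt_neg y).exp.div ((hasDerivAt_one_sub_exp_neg y).pow 2)
      (pow_pos hE 2).ne')).congr_deriv ?_
  have := hE.ne'
  simp
  field_simp
  ring

theorem one_sub_exp_neg_eq (y : ℝ) :
    1 - Real.exp (-y) = 2 * Real.sinh (y / 2) * Real.exp (-(y / 2)) := by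
  have h1 : Real.exp (-y) = Real.exp (-(y / 2)) ^ 2 := by rw [← Real.exp_nat_mul]; ring_nf
  have h2 : Real.exp (y / 2) * Real.exp (-(y / 2)) = 1 := by rw [← Real.exp_add]; simp
  rw [Real.sinh_eq, h1]
  linear_combination -h2

theorem one_add_exp_neg_eq (y : ℝ) :
    1 + Real.exp (-y) = 2 * Real.cosh (y / 2) * Real.exp (-(y / 2)) := by
  have h1 : Real.exp (-y) = Real.exp (-(y / 2)) ^ 2 := by rw [← Real.exp_nat_mul]; ring_nf
  have h2 : Real.exp (y / 2) * Real.exp (-(y / 2)) = 1 := by rw [← Real.exp_add]; simp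
  rw [Real.cosh_eq, h1]
  linear_combination -h2

theorem weightDeriv_pos {y : ℝ} (hy : 0 < y) : 0 < weightDeriv y := by
  have hS : y / 2 < Real.sinh (y / 2) := Real.self_lt_sinh_iff.2 (by positivity)
  have h1 : Real.exp (-y) = Real.exp (-(y / 2)) ^ 2 := by rw [← Real.exp_nat_mul]; ring_nf
  have hE := Real.exp_pos (-(y / 2))
  rw [weightDeriv, one_sub_exp_neg_eq, h1, sub_pos,
    div_lt_div_iff₀ (by have : 0 < Real.sinh (y / 2) := by linarith
                        positivity) (by positivity)]
  have h2 : y ^ 2 < (2 * Real.sinh (y / 2)) ^ 2 := by gcongr; linarith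
  nlinarith [mul_lt_mul_of_pos_right h2 (pow_pos hE 2)]

theorem antitoneOn_weightDeriv : AntitoneOn weightDeriv (Set.Ioi 0) := by
  refine antitoneOn_of_deriv_nonpos (convex_Ioi 0)
    (fun y hy => (hasDerivAt_weightDeriv hy).continuousAt.continuousWithinAt)
    (fun y hy => (hasDerivAt_weightDeriv (by simpa using hy)).differentiableAt.differentiableWithinAt)
    fun y hy => ?_
  have hy : 0 < y := by simpa using hy
  have h1 : Real.exp (-y) = Real.exp (-(y / 2)) ^ 2 := by rw [← Real.exp_nat_mul]; ring_nf
  have hE := Real.exp_pos (-(y / 2))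
  have hS : 0 < Real.sinh (y / 2) := Real.sinh_pos_iff.2 (by positivity)
  have h := pow_three_mul_cosh_le_sinh_pow_three (x := y / 2) (by positivity)
  rw [(hasDerivAt_weightDeriv hy).deriv, one_add_exp_neg_eq, one_sub_exp_neg_eq, h1, sub_nonpos,
    div_le_div_iff₀ (by positivity) (by positivity)]
  nlinarith [mul_le_mul_of_nonneg_right h (pow_pos hE 3).le]

theorem weight_pos {y : ℝ} (hy : 0 < y) : 0 < weight y := by
  have hE := one_sub_exp_neg_pos hy
  have h := Real.add_one_lt_exp (neg_ne_zero.2 hy.ne')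
  rw [weight, sub_pos]
  exact one_div_lt_one_div_of_lt hE (by linarith)

theorem weight_add_sub_le {y t : ℝ} (hy : 0 < y) (ht : 0 < t) :
    weight (y + t) - weight y ≤ t * weightDeriv y := by
  obtain ⟨c, hc, h⟩ := exists_hasDerivAt_eq_slope weight weightDeriv (a := y) (b := y + t)
    (by linarith)
    (fun z hz => (hasDerivAt_weight (hy.trans_le hz.1)).continuousAt.continuousWithinAt)
    fun z hz => hasDerivAt_weight (hy.trans hz.1)
  have h2 := antitoneOn_weightDeriv (Set.mem_Ioi.2 hy) (Set.mem_Ioi.2 (hy.trans hc.1)) hc.1.le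
  rw [h, add_sub_cancel_left, div_le_iff₀ ht] at h2
  linarith

/-- Partial sums of `F (exp (-t))`, as a geometric average of `weight`. -/
noncomputable def partialAvg (N : ℕ) (t : ℝ) : ℝ :=
  ∑ m ∈ Finset.range N,
    (Real.exp (-(m * t)) - Real.exp (-((m + 1) * t))) * weight ((m + 1) * t)

/-- The derivative of `partialAvg`. -/
noncomputable def partialAvgDeriv (N : ℕ) (t : ℝ) : ℝ :=
  ∑ m ∈ Finset.range N,
    (((m + 1) * Real.exp (-((m + 1) * t)) - m * Real.exp (-(m * t))) * weight ((m + 1) * t) +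
      (Real.exp (-(m * t)) - Real.exp (-((m + 1) * t))) * ((m + 1) * weightDeriv ((m + 1) * t)))

theorem hasDerivAt_partialAvg (N : ℕ) {t : ℝ} (ht : 0 < t) :
    HasDerivAt (partialAvg N) (partialAvgDeriv N t) t := by
  have hexp (a : ℝ) : HasDerivAt (fun t => Real.exp (-(a * t))) (-(a * Real.exp (-(a * t)))) t := by
    refine ((hasDerivAt_id t).const_mul a).neg.exp.congr_deriv ?_
    simp
    ring
  refine HasDerivAt.fun_sum fun m _ => ?_
  have hw : HasDerivAt (fun t => weight ((m + 1 : ℝ) * t))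
      ((m + 1) * weightDeriv ((m + 1) * t)) t := by
    refine ((hasDerivAt_weight (y := (m + 1 : ℝ) * t) (by positivity)).comp t
      ((hasDerivAt_id t).const_mul (m + 1 : ℝ))).congr_deriv ?_
    simp
    ring
  refine (((hexp m).sub (hexp (m + 1))).mul hw).congr_deriv ?_
  simp only [Pi.sub_apply]
  ring

/-- A lower bound, uniform in `N`, for the derivative of `partialAvg`. -/
noncomputable def derivBound (t : ℝ) : ℝ := weightDeriv t * (1 - Real.exp (-t) * (1 + t))

theorem derivBound_pos {t : ℝ} (ht : 0 < t) : 0 < derivBound t := by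
  refine mul_pos (weightDeriv_pos ht) ?_
  have h := Real.add_one_lt_exp ht.ne'
  have h2 : Real.exp (-t) * Real.exp t = 1 := by rw [← Real.exp_add]; simp
  nlinarith [mul_lt_mul_of_pos_left h (Real.exp_pos (-t))]

theorem derivBound_add_le_partialAvgDeriv (N : ℕ) {t : ℝ} (ht : 0 < t) :
    derivBound t + (N + 1) * Real.exp (-((N + 1) * t)) * weight ((N + 2) * t) ≤
      partialAvgDeriv (N + 1) t := by
  have hstep (m : ℕ) : (m + 1) * weightDeriv ((m + 1) * t) * Real.exp (-(m * t)) *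
        (1 - Real.exp (-t) * (1 + t)) ≤
      (Real.exp (-(m * t)) - Real.exp (-((m + 1) * t))) * ((m + 1) * weightDeriv ((m + 1) * t)) -
      (m + 1) * Real.exp (-((m + 1) * t)) * (weight ((m + 2) * t) - weight ((m + 1) * t)) := by
    have hE : Real.exp (-((m + 1) * t)) = Real.exp (-(m * t)) * Real.exp (-t) := by
      rw [← Real.exp_add]; ring_nf
    have h := weight_add_sub_le (y := (m + 1) * t) (by positivity) ht
    rw [show (m + 1) * t + t = (m + 2) * t by ring] at h
    have h3 := mul_le_mul_of_nonneg_left h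
      (by positivity : 0 ≤ (m + 1) * Real.exp (-((m + 1) * t)))
    rw [hE] at h3 ⊢
    linarith
  induction N with
  | zero =>
    have := hstep 0
    simp [partialAvgDeriv, derivBound] at this ⊢
    linarith
  | succ N ih =>
    have h := hstep (N + 1)
    have hnn : 0 ≤ ((N + 1 : ℕ) + 1) * weightDeriv (((N + 1 : ℕ) + 1) * t) *
        Real.exp (-((N + 1 : ℕ) * t)) * (1 - Real.exp (-t) * (1 + t)) := by
      have h1 := weightDeriv_pos (y := ((N + 1 : ℕ) + 1) * t) (by positivity)
      have h2 : 0 < 1 - Real.exp (-t) * (1 + t) :=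
        pos_of_mul_pos_right (derivBound_pos ht) (weightDeriv_pos ht).le
      positivity
    rw [partialAvgDeriv, Finset.sum_range_succ, ← partialAvgDeriv]
    push_cast at h hnn ⊢
    rw [show (N : ℝ) + 2 = N + 1 + 1 by ring] at ih
    linarith

theorem derivBound_le_partialAvgDeriv (N : ℕ) {t : ℝ} (ht : 0 < t) :
    derivBound t ≤ partialAvgDeriv (N + 1) t := by
  have := weight_pos (y := (N + 2) * t) (by positivity)
  exact (le_add_of_nonneg_right (by positivity)).trans (derivBound_add_le_partialAvgDeriv N ht)

theorem exists_pos_mul_sub_le_partialAvg_sub {a b : ℝ} (ha : 0 < a) (hab : a < b) :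
    ∃ δ > 0, ∀ N, δ * (b - a) ≤ partialAvg (N + 1) b - partialAvg (N + 1) a := by
  have hcont : ContinuousOn derivBound (Set.Icc a b) := fun t ht =>
    ((hasDerivAt_weightDeriv (ha.trans_le ht.1)).continuousAt.mul
      (by fun_prop)).continuousWithinAt
  obtain ⟨c, hc, hmin⟩ := isCompact_Icc.exists_isMinOn (Set.nonempty_Icc.2 hab.le) hcont
  refine ⟨derivBound c, derivBound_pos (ha.trans_le hc.1), fun N => ?_⟩
  have hd (t : ℝ) (ht : t ∈ Set.Icc a b) := hasDerivAt_partialAvg (N + 1) (ha.trans_le ht.1)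
  refine (convex_Icc a b).mul_sub_le_image_sub_of_le_deriv
    (fun t ht => (hd t ht).continuousAt.continuousWithinAt)
    (fun t ht => (hd t (interior_subset ht)).differentiableAt.differentiableWithinAt)
    (fun t ht => ?_) a (Set.left_mem_Icc.2 hab.le) b (Set.right_mem_Icc.2 hab.le) hab.le
  have ht := interior_subset ht
  rw [(hd t ht).deriv]
  exact (hmin ht).trans (derivBound_le_partialAvgDeriv N (ha.trans_le ht.1))

theorem hasSum_T {q : ℝ} (hq : |q| < 1) :
    HasSum (fun m : ℕ => q ^ (m + 1) / (1 - q ^ (m + 1))) (T q) := by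
  have hs : Summable fun m : ℕ => q ^ (m + 1) / (1 - q ^ (m + 1)) := by
    simpa using (summable_nat_add_iff 1).2
      (summable_norm_pow_mul_geometric_div_one_sub (𝕜 := ℝ) 0 (r := q) hq)
  have h := tsum_pow_div_one_sub_eq_tsum_sigma (𝕜 := ℝ) (r := q) hq 0
  simp only [pow_zero, one_mul, ArithmeticFunction.sigma_zero_apply] at h
  rw [tsum_pnat_eq_tsum_succ (f := fun n : ℕ => q ^ n / (1 - q ^ n)),
    PNat.coe_injective.tsum_eq (f := fun n : ℕ => (n.divisors.card : ℝ) * q ^ n)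
      fun n hn => ⟨⟨n, Nat.pos_of_ne_zero fun h => hn (by simp [h])⟩, rfl⟩] at h
  rw [T]
  simp only [numDivisors]
  rw [← h]
  exact hs.hasSum

theorem tendsto_partialAvg {q : ℝ} (hq : q ∈ Set.Ioo (0 : ℝ) 1) :
    Tendsto (fun N => partialAvg N (-Real.log q)) atTop (𝓝 (F q)) := by
  obtain ⟨h0, h1⟩ := hq
  have hlog : Real.log q < 0 := Real.log_neg h0 h1
  have habs : |q| < 1 := by rwa [abs_of_pos h0]
  have h := ((hasSum_T habs).sub
    ((Real.hasSum_pow_div_log_of_abs_lt_one habs).div_const (-Real.log q))).mul_left ((1 - q) / q)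
  rw [neg_div_neg_eq] at h
  refine (show HasSum _ (F q) from h).tendsto_sum_nat.congr fun N => Finset.sum_congr rfl fun m _ => ?_
  have hexp (k : ℕ) : Real.exp (-(k * -Real.log q)) = q ^ k := by
    rw [mul_neg, neg_neg, Real.exp_nat_mul, Real.exp_log h0]
  have hm := hexp (m + 1)
  push_cast at hm
  have hne : 1 - q ^ (m + 1) ≠ 0 := (sub_pos.2 (pow_lt_one₀ h0.le h1 (by simp))).ne'
  rw [weight, hexp, hm]
  have := hlog.ne
  have : (m + 1 : ℝ) ≠ 0 := by positivity
  field_simp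
  ring

end LambertMonotone

/-- The function `F` is strictly decreasing on `(0,1)`. -/
theorem F_strictAntiOn : StrictAntiOn F (Set.Ioo (0 : ℝ) 1) := by
  intro p hp q hq hpq
  have hlog : -Real.log q < -Real.log p := neg_lt_neg (Real.log_lt_log hp.1 hpq)
  obtain ⟨δ, hδ, h⟩ := LambertMonotone.exists_pos_mul_sub_le_partialAvg_sub
    (neg_pos.2 (Real.log_neg hq.1 hq.2)) hlog
  have hlim := ge_of_tendsto'
    (((LambertMonotone.tendsto_partialAvg hp).comp (tendsto_add_atTop_nat 1)).sub
      ((LambertMonotone.tendsto_partialAvg hq).comp (tendsto_add_atTop_nat 1))) h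
  linarith [mul_pos hδ (sub_pos.2 hlog)]
end

section
/- For all real numbers r and s with 0 < r < s < 1, one has r(1−s)/(s(1−r)) < H(r)/H(s) < 1, where H(q) = T(q) − log(1−q)/log(q). -/
open Real Filter Topology

lemma pos_of_hasDerivAt_pos {f f' : ℝ → ℝ} (hf : ∀ x, HasDerivAt f (f' x) x) (h0 : f 0 = 0)
    (hf' : ∀ x, 0 < x → 0 < f' x) {x : ℝ} (hx : 0 < x) : 0 < f x := by
  have hmono : StrictMonoOn f (Set.Ici 0) :=
    strictMonoOn_of_deriv_pos (convex_Ici 0) (fun y _ => (hf y).continuousAt.continuousWithinAt)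
      fun y hy => by
        rw [interior_Ici] at hy
        rw [(hf y).deriv]
        exact hf' y hy
  simpa [h0] using hmono Set.self_mem_Ici hx.le hx

lemma sinh_lt_mul_cosh {v : ℝ} (hv : 0 < v) : sinh v < v * cosh v := by
  refine sub_pos.1 (pos_of_hasDerivAt_pos (f := fun v => v * cosh v - sinh v)
    (f' := fun v => v * sinh v) (fun x => ?_) (by simp)
    (fun x hx => mul_pos hx (sinh_pos_iff.2 hx)) hv)
  exact (((hasDerivAt_id' x).mul (hasDerivAt_cosh x)).sub (hasDerivAt_sinh x)).congr_deriv
    (by ring)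

/-- Lazarević's inequality. -/
lemma pow_three_mul_cosh_lt_sinh_pow_three {v : ℝ} (hv : 0 < v) :
    v ^ 3 * cosh v < sinh v ^ 3 := by
  have key : 0 < sinh v * cosh v ^ (-1 / 3 : ℝ) - v := by
    refine pos_of_hasDerivAt_pos (f := fun v => sinh v * cosh v ^ (-1 / 3 : ℝ) - v)
      (f' := fun x => cosh x * cosh x ^ (-1 / 3 : ℝ) +
        sinh x * (sinh x * (-1 / 3) * cosh x ^ (-1 / 3 - 1 : ℝ)) - 1) (fun x => ?_) (by simp)
      (fun x hx => ?_) hv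
    · exact ((hasDerivAt_sinh x).mul ((hasDerivAt_cosh x).rpow_const
        (Or.inl (cosh_pos x).ne'))).sub (hasDerivAt_id' x)
    · have hc := cosh_pos x
      have h1 : 1 < cosh x := one_lt_cosh.2 hx.ne'
      rw [rpow_sub_one hc.ne']
      set a := cosh x ^ (-1 / 3 : ℝ) with ha
      have ha0 : 0 < a := rpow_pos_of_pos hc _
      have ha3 : a ^ 3 * cosh x = 1 := by
        rw [ha, ← rpow_natCast, ← rpow_mul hc.le]
        norm_num [rpow_neg_one, hc.ne']
      have hs := cosh_sq x
      have ha1 : a < 1 := rpow_lt_one_of_one_lt_of_neg h1 (by norm_num)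
      have hca : cosh x = 1 / a ^ 3 := by field_simp; linarith
      have hss : sinh x ^ 2 = 1 / a ^ 6 - 1 := by
        rw [eq_sub_iff_add_eq, ← hs, hca]; field_simp
      have ha2 : a ^ 2 - 1 ≠ 0 := by nlinarith
      have : cosh x * a + sinh x * (sinh x * (-1 / 3) * (a / cosh x)) - 1
          = (2 + a ^ 2) * (a ^ 2 - 1) ^ 2 / (3 * a ^ 2) := by
        have : sinh x * (sinh x * (-1 / 3) * (a / cosh x)) =
          sinh x ^ 2 * (-1 / 3) * (a / cosh x) := by ring
        rw [this, hss, hca]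
        field_simp
        ring
      rw [this]
      positivity
  have hc := cosh_pos v
  have h3 : (cosh v ^ (-1 / 3 : ℝ)) ^ 3 = (cosh v)⁻¹ := by
    rw [← rpow_natCast, ← rpow_mul hc.le]
    norm_num [rpow_neg_one]
  have := pow_lt_pow_left₀ (sub_pos.1 key) hv.le three_ne_zero
  rwa [mul_pow, h3, ← div_eq_mul_inv, lt_div_iff₀ hc] at this

/-- The function `u ↦ 1 / (1 - exp (-u)) - 1 / u`, in hyperbolic form. -/
noncomputable def lambertWeight (u : ℝ) : ℝ :=
  1 / 2 + cosh (u / 2) / (2 * sinh (u / 2)) - 1 / u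

/-- The derivative of `lambertWeight`. -/
noncomputable def lambertWeightDeriv (u : ℝ) : ℝ :=
  1 / u ^ 2 - 1 / (4 * sinh (u / 2) ^ 2)

lemma lambertWeight_eq {u : ℝ} (hu : 0 < u) :
    lambertWeight u = 1 / (1 - exp (-u)) - 1 / u := by
  have h1 : exp (-u) = exp (-(u / 2)) ^ 2 := by rw [← exp_nat_mul]; congr 1; push_cast; ring
  have h2 : 0 < exp (-(u / 2)) := exp_pos _
  have h3 : exp (-(u / 2)) < 1 := exp_lt_one_iff.2 (by linarith)
  have h4 : exp (u / 2) = 1 / exp (-(u / 2)) := by rw [exp_neg]; simp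
  rw [lambertWeight, cosh_eq, sinh_eq, h1, h4]
  set e := exp (-(u / 2))
  have h5 : 1 - e ^ 2 ≠ 0 := by nlinarith
  have h6 : 1 / e - e ≠ 0 := by
    rw [show 1 / e - e = (1 - e ^ 2) / e by field_simp]
    positivity
  congr 1
  field_simp
  ring

lemma hasDerivAt_lambertWeight {u : ℝ} (hu : 0 < u) :
    HasDerivAt lambertWeight (lambertWeightDeriv u) u := by
  have hs : 0 < sinh (u / 2) := sinh_pos_iff.2 (by linarith)
  have hd : HasDerivAt (fun u : ℝ => u / 2) (1 / 2) u := (hasDerivAt_id' u).div_const 2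
  have h := (((hd.cosh.div (hd.sinh.const_mul 2) (by positivity)).const_add (1 / 2)).sub
    ((hasDerivAt_id' u).inv hu.ne'))
  have hw : lambertWeight = fun u : ℝ =>
      1 / 2 + cosh (u / 2) / (2 * sinh (u / 2)) - u⁻¹ := by
    ext u; simp [lambertWeight]
  rw [hw]
  refine h.congr_deriv ?_
  rw [lambertWeightDeriv]
  have := cosh_sq (u / 2)
  field_simp
  rw [this]
  ring

lemma half_lt_lambertWeight {u : ℝ} (hu : 0 < u) : 1 / 2 < lambertWeight u := by
  have hs : 0 < sinh (u / 2) := sinh_pos_iff.2 (by linarith)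
  have h := sinh_lt_mul_cosh (half_pos hu)
  have : 1 / u < cosh (u / 2) / (2 * sinh (u / 2)) := by
    rw [div_lt_div_iff₀ hu (by positivity)]
    linarith
  rw [lambertWeight]
  linarith

lemma lambertWeightDeriv_pos {u : ℝ} (hu : 0 < u) : 0 < lambertWeightDeriv u := by
  have hs : u / 2 < sinh (u / 2) := self_lt_sinh_iff.2 (by linarith)
  rw [lambertWeightDeriv, sub_pos]
  apply one_div_lt_one_div_of_lt (by positivity)
  nlinarith

lemma lambertWeightDeriv_lt {u : ℝ} (hu : 0 < u) : lambertWeightDeriv u < lambertWeight u := by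
  have hs : 0 < sinh (u / 2) := sinh_pos_iff.2 (by linarith)
  have h := half_lt_lambertWeight hu
  have hd : lambertWeightDeriv u =
      (1 / u) ^ 2 + 1 / 4 - (cosh (u / 2) / (2 * sinh (u / 2))) ^ 2 := by
    rw [lambertWeightDeriv, div_pow _ (2 * _), cosh_sq]
    field_simp
    ring
  rw [hd]
  rw [lambertWeight] at h ⊢
  have : 0 < 1 / u := by positivity
  nlinarith

lemma antitoneOn_lambertWeightDeriv : AntitoneOn lambertWeightDeriv (Set.Ioi 0) := by
  have hd (u : ℝ) (hu : 0 < u) : HasDerivAt lambertWeightDeriv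
      (cosh (u / 2) / (4 * sinh (u / 2) ^ 3) - 2 / u ^ 3) u := by
    have hs : 0 < sinh (u / 2) := sinh_pos_iff.2 (by linarith)
    have hd : HasDerivAt (fun u : ℝ => u / 2) (1 / 2) u := (hasDerivAt_id' u).div_const 2
    have hw : lambertWeightDeriv = fun u : ℝ => (u ^ 2)⁻¹ - (4 * sinh (u / 2) ^ 2)⁻¹ := by
      ext u; simp [lambertWeightDeriv]
    rw [hw]
    refine (((hasDerivAt_pow 2 u).inv (by positivity)).sub
      (((hd.sinh.fun_pow 2).const_mul 4).fun_inv (by positivity))).congr_deriv ?_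
    push_cast
    field_simp
    ring
  refine antitoneOn_of_deriv_nonpos (convex_Ioi 0)
    (fun u hu => (hd u hu).continuousAt.continuousWithinAt)
    (fun u hu => (hd u (interior_subset hu)).differentiableAt.differentiableWithinAt)
    fun u hu => ?_
  have hu : 0 < u := interior_subset hu
  have hs : 0 < sinh (u / 2) := sinh_pos_iff.2 (by linarith)
  have h := pow_three_mul_cosh_lt_sinh_pow_three (half_pos hu)
  rw [(hd u hu).deriv, sub_nonpos, div_le_div_iff₀ (by positivity) (by positivity)]
  nlinarith

lemma lambertWeight_sub_le {a b : ℝ} (ha : 0 < a) (hab : a < b) :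
    lambertWeight b - lambertWeight a ≤ (b - a) * lambertWeightDeriv a := by
  obtain ⟨c, hc, hc'⟩ := exists_hasDerivAt_eq_slope lambertWeight lambertWeightDeriv hab
    (fun x hx => (hasDerivAt_lambertWeight (ha.trans_le hx.1)).continuousAt.continuousWithinAt)
    (fun x hx => hasDerivAt_lambertWeight (ha.trans hx.1))
  have h := antitoneOn_lambertWeightDeriv ha (ha.trans hc.1) hc.1.le
  rw [hc', div_le_iff₀ (by linarith)] at h
  linarith

lemma strictAntiOn_exp_neg_mul_lambertWeight :
    StrictAntiOn (fun u => exp (-u) * lambertWeight u) (Set.Ioi 0) := by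
  have hd (u : ℝ) (hu : 0 < u) : HasDerivAt (fun u => exp (-u) * lambertWeight u)
      (exp (-u) * (lambertWeightDeriv u - lambertWeight u)) u :=
    ((hasDerivAt_neg u).exp.mul (hasDerivAt_lambertWeight hu)).congr_deriv (by ring)
  refine strictAntiOn_of_deriv_neg (convex_Ioi 0)
    (fun u hu => (hd u hu).continuousAt.continuousWithinAt) fun u hu => ?_
  have hu : 0 < u := interior_subset hu
  rw [(hd u hu).deriv]
  exact mul_neg_of_pos_of_neg (exp_pos _) (sub_neg.2 (lambertWeightDeriv_lt hu))

/-- The partial sums, after summation by parts, of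
`(1 - exp (-t)) * ∑ m, exp (-m * t) * lambertWeight ((m + 1) * t)`. -/
noncomputable def lambertMean (N : ℕ) (t : ℝ) : ℝ :=
  lambertWeight t + ∑ m ∈ Finset.range N, exp (-((m + 1) * t)) *
    (lambertWeight ((m + 2) * t) - lambertWeight ((m + 1) * t))

/-- The derivative of `lambertMean N`. -/
noncomputable def lambertMeanDeriv (N : ℕ) (t : ℝ) : ℝ :=
  lambertWeightDeriv t + ∑ m ∈ Finset.range N, exp (-((m + 1) * t)) *
    ((m + 2) * lambertWeightDeriv ((m + 2) * t) - (m + 1) * lambertWeightDeriv ((m + 1) * t) -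
      (m + 1) * (lambertWeight ((m + 2) * t) - lambertWeight ((m + 1) * t)))

lemma hasDerivAt_lambertMean (N : ℕ) {t : ℝ} (ht : 0 < t) :
    HasDerivAt (lambertMean N) (lambertMeanDeriv N t) t := by
  have hw (c : ℝ) (hc : 0 < c) : HasDerivAt (fun t => lambertWeight (c * t))
      (c * lambertWeightDeriv (c * t)) t :=
    ((hasDerivAt_lambertWeight (mul_pos hc ht)).comp t
      ((hasDerivAt_id' t).const_mul c)).congr_deriv (by ring)
  refine (hasDerivAt_lambertWeight ht).add (HasDerivAt.fun_sum fun m _ => ?_)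
  have he : HasDerivAt (fun t : ℝ => exp (-((m + 1) * t)))
      (-(m + 1) * exp (-((m + 1) * t))) t :=
    ((hasDerivAt_id' t).const_mul ((m : ℝ) + 1)).fun_neg.exp.congr_deriv (by ring)
  exact (he.fun_mul ((hw (m + 2) (by positivity)).fun_sub (hw (m + 1) (by positivity)))).congr_deriv
    (by ring)

lemma le_lambertMeanDeriv (N : ℕ) {t : ℝ} (ht : 0 < t) :
    lambertWeightDeriv t * (1 - (1 + t) * exp (-t)) ≤ lambertMeanDeriv (N + 1) t := by
  have hstep (m : ℕ) : lambertWeight ((m + 2) * t) - lambertWeight ((m + 1) * t) ≤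
      t * lambertWeightDeriv ((m + 1) * t) := by
    refine (lambertWeight_sub_le (by positivity) (by nlinarith)).trans_eq ?_
    ring
  suffices h : lambertWeightDeriv t * (1 - (1 + t) * exp (-t)) +
      (N + 2) * exp (-((N + 1) * t)) * lambertWeightDeriv ((N + 2) * t) ≤
        lambertMeanDeriv (N + 1) t by
    have : 0 < (N + 2) * exp (-((N + 1) * t)) * lambertWeightDeriv ((N + 2) * t) :=
      mul_pos (by positivity) (lambertWeightDeriv_pos (by positivity))
    linarith
  induction N with
  | zero =>
    have h := mul_le_mul_of_nonneg_left (hstep 0) (exp_pos (-t)).le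
    simp [lambertMeanDeriv] at h ⊢
    linarith
  | succ N ih =>
    have hN : lambertMeanDeriv (N + 1 + 1) t = lambertMeanDeriv (N + 1) t +
        exp (-((N + 2) * t)) *
          ((N + 3) * lambertWeightDeriv ((N + 3) * t) -
            (N + 2) * lambertWeightDeriv ((N + 2) * t) -
            (N + 2) * (lambertWeight ((N + 3) * t) - lambertWeight ((N + 2) * t))) := by
      rw [lambertMeanDeriv, Finset.sum_range_succ, ← add_assoc, ← lambertMeanDeriv]
      push_cast
      ring_nf
    have h := hstep (N + 1)
    push_cast at h ⊢
    rw [show (N : ℝ) + 1 + 2 = N + 3 by ring, show (N : ℝ) + 1 + 1 = N + 2 by ring] at *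
    rw [hN]
    have hexp : exp (-((N + 1) * t)) = exp (-((N + 2) * t)) * exp t := by
      rw [← exp_add]; congr 1; ring
    rw [hexp] at ih
    have hx := add_one_le_exp t
    have hW : 0 < lambertWeightDeriv ((N + 2) * t) := lambertWeightDeriv_pos (by positivity)
    have hE := exp_pos (-((N + 2) * t))
    have h1 : 0 ≤ exp (-((N + 2) * t)) * ((N + 2) * (lambertWeightDeriv ((N + 2) * t) *
        (exp t - (t + 1)))) := by
      have : 0 ≤ exp t - (t + 1) := sub_nonneg.2 hx
      positivity
    have h2 : 0 ≤ exp (-((N + 2) * t)) * ((N + 2) * (t * lambertWeightDeriv ((N + 2) * t) -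
        (lambertWeight ((N + 3) * t) - lambertWeight ((N + 2) * t)))) := by
      have := sub_nonneg.2 h
      positivity
    linarith

/-- Uniform strict monotonicity of the functions `lambertMean (N + 1)`. -/
lemma exists_pos_le_lambertMean_sub {a b : ℝ} (ha : 0 < a) (hab : a < b) :
    ∃ c > 0, ∀ N, c ≤ lambertMean (N + 1) b - lambertMean (N + 1) a := by
  have hE (t : ℝ) (ht : 0 < t) : (1 + t) * exp (-t) < 1 := by
    rw [exp_neg, ← div_eq_mul_inv, div_lt_one (exp_pos t), add_comm]
    exact add_one_lt_exp ht.ne'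
  have hmono : AntitoneOn (fun t : ℝ => (1 + t) * exp (-t)) (Set.Ici 0) := by
    have hd (t : ℝ) : HasDerivAt (fun t : ℝ => (1 + t) * exp (-t)) (-t * exp (-t)) t :=
      (((hasDerivAt_id' t).const_add 1).mul (hasDerivAt_neg t).exp).congr_deriv (by ring)
    refine antitoneOn_of_deriv_nonpos (convex_Ici 0)
      (fun t _ => (hd t).continuousAt.continuousWithinAt)
      (fun t _ => (hd t).differentiableAt.differentiableWithinAt) fun t ht => ?_
    have ht : 0 ≤ t := interior_subset ht
    rw [(hd t).deriv]
    exact mul_nonpos_of_nonpos_of_nonneg (by linarith) (exp_pos _).le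
  have hb : 0 < lambertWeightDeriv b := lambertWeightDeriv_pos (ha.trans hab)
  have ha' : 0 < 1 - (1 + a) * exp (-a) := sub_pos.2 (hE a ha)
  refine ⟨lambertWeightDeriv b * (1 - (1 + a) * exp (-a)) * (b - a),
    mul_pos (mul_pos hb ha') (sub_pos.2 hab), fun N => ?_⟩
  refine (convex_Icc a b).mul_sub_le_image_sub_of_le_deriv
    (fun t ht => (hasDerivAt_lambertMean _ (ha.trans_le ht.1)).continuousAt.continuousWithinAt)
    (fun t ht => (hasDerivAt_lambertMean _ (ha.trans_le
      (interior_subset ht).1)).differentiableAt.differentiableWithinAt)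
    (fun t ht => ?_) a (Set.left_mem_Icc.2 hab.le) b (Set.right_mem_Icc.2 hab.le) hab.le
  obtain ⟨hat, htb⟩ := interior_subset ht
  have ht0 : 0 < t := ha.trans_le hat
  rw [(hasDerivAt_lambertMean _ ht0).deriv]
  refine le_trans ?_ (le_lambertMeanDeriv N ht0)
  exact mul_le_mul (antitoneOn_lambertWeightDeriv ht0 (ha.trans hab) htb)
    (sub_le_sub_left (hmono ha.le ht0.le hat) 1) ha'.le (lambertWeightDeriv_pos ht0).le

lemma one_sub_mul_sum_lambertWeight (N : ℕ) (t : ℝ) :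
    (1 - exp (-t)) * ∑ m ∈ Finset.range (N + 1), exp (-(m * t)) * lambertWeight ((m + 1) * t) =
      lambertMean N t - exp (-((N + 1) * t)) * lambertWeight ((N + 1) * t) := by
  induction N with
  | zero => simp [lambertMean]; ring
  | succ N ih =>
    rw [Finset.sum_range_succ, mul_add, ih, lambertMean, lambertMean, Finset.sum_range_succ]
    have hexp : exp (-((N + 1 + 1) * t)) = exp (-((N + 1) * t)) * exp (-t) := by
      rw [← exp_add]; congr 1; ring
    push_cast
    rw [hexp, show (N : ℝ) + 1 + 1 = N + 2 by ring]
    ring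

lemma T_eq_tsum {q : ℝ} (hq : |q| < 1) : T q = ∑' n : ℕ, q ^ (n + 1) / (1 - q ^ (n + 1)) := by
  have h := tsum_pow_div_one_sub_eq_tsum_sigma (r := q) (by simpa using hq) 0
  rw [tsum_pnat_eq_tsum_succ (f := fun n : ℕ => (n : ℝ) ^ 0 * q ^ n / (1 - q ^ n)),
    tsum_pnat_eq_tsum_succ (f := fun n : ℕ => (ArithmeticFunction.sigma 0 n : ℝ) * q ^ n)] at h
  simp only [pow_zero, one_mul, ArithmeticFunction.sigma_zero_apply] at h
  rw [h, T]
  refine ((add_left_injective 1).tsum_eq fun n hn => ?_).symm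
  cases n with
  | zero => simp [numDivisors] at hn
  | succ n => exact ⟨n, rfl⟩

lemma hasSum_H {q : ℝ} (h0 : 0 < q) (h1 : q < 1) :
    HasSum (fun n : ℕ => exp (-((n + 1) * -log q)) * lambertWeight ((n + 1) * -log q)) (H q) := by
  have hq : |q| < 1 := abs_lt.2 ⟨by linarith, h1⟩
  have hlog : log q < 0 := log_neg h0 h1
  have hs : Summable fun n : ℕ => q ^ (n + 1) / (1 - q ^ (n + 1)) := by
    simpa using (summable_nat_add_iff 1).2
      (summable_norm_pow_mul_geometric_div_one_sub (r := q) 0 (by simpa using hq))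
  have hT := hs.hasSum
  rw [← T_eq_tsum hq] at hT
  have hL := (hasSum_pow_div_log_of_abs_lt_one hq).div_const (log q)
  convert! hT.add hL using 1
  · ext n
    have hexp : exp (-((n + 1) * -log q)) = q ^ (n + 1) := by
      rw [show -((n + 1) * -log q) = ((n + 1 : ℕ) : ℝ) * log q by push_cast; ring, exp_nat_mul,
        exp_log h0]
    rw [lambertWeight_eq (mul_pos (by positivity) (neg_pos.2 hlog)), hexp]
    have : (1 : ℝ) - q ^ (n + 1) ≠ 0 := (sub_pos.2 (pow_lt_one₀ h0.le h1 n.succ_ne_zero)).ne'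
    field_simp
    ring
  · rw [H]; ring

lemma H_pos {q : ℝ} (h0 : 0 < q) (h1 : q < 1) : 0 < H q := by
  have hlog : 0 < -log q := neg_pos.2 (log_neg h0 h1)
  have hpos (n : ℕ) :
      0 < exp (-((n + 1) * -log q)) * lambertWeight ((n + 1) * -log q) :=
    mul_pos (exp_pos _) (one_half_pos.trans (half_lt_lambertWeight (by positivity)))
  rw [← (hasSum_H h0 h1).tsum_eq]
  exact (hasSum_H h0 h1).summable.tsum_pos (fun n => (hpos n).le) 0 (hpos 0)

lemma H_lt_H {r s : ℝ} (hr : 0 < r) (hrs : r < s) (hs : s < 1) : H r < H s := by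
  have hlr : 0 < -log s := neg_pos.2 (log_neg (hr.trans hrs) hs)
  have hlog : -log s < -log r := neg_lt_neg (log_lt_log hr hrs)
  have h (n : ℕ) := strictAntiOn_exp_neg_mul_lambertWeight
    (show ((n : ℝ) + 1) * -log s ∈ Set.Ioi 0 from mul_pos (by positivity) hlr)
    (show ((n : ℝ) + 1) * -log r ∈ Set.Ioi 0 from mul_pos (by positivity) (hlr.trans hlog))
    (mul_lt_mul_of_pos_left hlog (by positivity))
  exact hasSum_lt (fun n => (h n).le) (h 0) (hasSum_H hr (hrs.trans hs))
    (hasSum_H (hr.trans hrs) hs)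

lemma tendsto_lambertMean {q : ℝ} (h0 : 0 < q) (h1 : q < 1) :
    Tendsto (fun N => lambertMean N (-log q)) atTop (𝓝 ((1 - q) / q * H q)) := by
  have hH := hasSum_H h0 h1
  have hexp : exp (- -log q) = q := by rw [neg_neg, exp_log h0]
  have hsum := ((tendsto_add_atTop_iff_nat 1).2 hH.tendsto_sum_nat).const_mul ((1 - q) / q)
  have hzero := hH.summable.tendsto_atTop_zero
  refine ((hsum.add hzero).congr fun N => ?_).trans_eq (by simp)
  have h := one_sub_mul_sum_lambertWeight N (-log q)
  rw [hexp] at h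
  rw [← eq_sub_iff_add_eq.1 h, div_mul_eq_mul_div, mul_div_assoc, Finset.sum_div]
  congr 2
  refine Finset.sum_congr rfl fun n _ => ?_
  have : exp (-((n + 1) * -log q)) = exp (-(n * -log q)) * exp (- -log q) := by
    rw [← exp_add]; congr 1; ring
  rw [this, hexp]
  field_simp

lemma one_sub_div_mul_H_lt {r s : ℝ} (hr : 0 < r) (hrs : r < s) (hs : s < 1) :
    (1 - s) / s * H s < (1 - r) / r * H r := by
  obtain ⟨c, hc, h⟩ := exists_pos_le_lambertMean_sub
    (neg_pos.2 (log_neg (hr.trans hrs) hs)) (neg_lt_neg (log_lt_log hr hrs))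
  have hlim := ((tendsto_lambertMean hr (hrs.trans hs)).sub
    (tendsto_lambertMean (hr.trans hrs) hs)).comp (tendsto_add_atTop_nat 1)
  have := ge_of_tendsto' hlim h
  linarith

/-- For `0 < r < s < 1` we have `r(1-s)/(s(1-r)) < H r / H s < 1`. -/
theorem H_ratio_bounds (r s : ℝ) (hr : 0 < r) (hrs : r < s) (hs : s < 1) :
    r * (1 - s) / (s * (1 - r)) < H r / H s ∧ H r / H s < 1 := by
  have hs0 : 0 < s := hr.trans hrs
  have hH : 0 < H s := H_pos hs0 hs
  refine ⟨?_, (div_lt_one hH).2 (H_lt_H hr hrs hs)⟩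
  have h := one_sub_div_mul_H_lt hr hrs hs
  rw [div_mul_eq_mul_div, div_mul_eq_mul_div, div_lt_div_iff₀ hs0 hr] at h
  rw [div_lt_div_iff₀ (mul_pos hs0 (by linarith)) hH]
  linarith
end

section
/- The function F(q) = ((1−q)/q)·(T(q) − log(1−q)/log(q)) satisfies lim_{q→0⁺} F(q) = 1 and lim_{q→1⁻} F(q) = γ, where γ is the Euler–Mascheroni constant. (Consequently, γ and 1 are the best possible constant factors α and β in the double inequality α·q/(1−q) + log(1−q)/log(q) < T(q) < β·q/(1−q) + log(1−q)/log(q) on (0,1).) -/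
open Filter Topology

/-- The Lambert series expansion of `T`. -/
lemma hasSum_T {q : ℝ} (h0 : 0 < q) (h1 : q < 1) :
    HasSum (fun k : ℕ ↦ q ^ (k + 1) / (1 - q ^ (k + 1))) (T q) := by
  have hq : ‖q‖ < 1 := by rwa [Real.norm_of_nonneg h0.le]
  have hs := summable_norm_pow_mul_geometric_div_one_sub 0 hq
  simp only [pow_zero, one_mul] at hs
  have hT : T q = ∑' k : ℕ, q ^ (k + 1) / (1 - q ^ (k + 1)) := by
    have h := tsum_pow_div_one_sub_eq_tsum_sigma hq 0
    simp only [pow_zero, one_mul, ArithmeticFunction.sigma_zero_apply] at h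
    rw [← tsum_pnat_eq_tsum_succ (f := fun k ↦ q ^ k / (1 - q ^ k)), h]
    refine (PNat.coe_injective.tsum_eq (f := fun k ↦ (numDivisors k : ℝ) * q ^ k) ?_).symm
    intro k hk
    refine ⟨⟨k, Nat.pos_of_ne_zero ?_⟩, rfl⟩
    rintro rfl
    simp [numDivisors] at hk
  rw [hT]
  exact ((summable_nat_add_iff 1).2 hs).hasSum

lemma T_bounds {q : ℝ} (h0 : 0 < q) (h1 : q < 1) : q ≤ T q ∧ T q ≤ q / (1 - q) ^ 2 := by
  have hq : ‖q‖ < 1 := by rwa [Real.norm_of_nonneg h0.le]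
  have hs := hasSum_coe_mul_geometric_of_norm_lt_one hq
  have hle (k : ℕ) : (numDivisors k : ℝ) * q ^ k ≤ k * q ^ k := by
    gcongr
    exact Nat.card_divisors_le_self k
  have hsum : Summable fun k : ℕ ↦ (numDivisors k : ℝ) * q ^ k :=
    hs.summable.of_nonneg_of_le (fun k ↦ by positivity) hle
  constructor
  · simpa [T, numDivisors] using hsum.le_tsum 1 (fun k _ ↦ by positivity)
  · rw [← hs.tsum_eq]
    exact hsum.tsum_le_tsum hle hs.summable

lemma tendsto_F_zero : Tendsto F (𝓝[>] 0) (𝓝 1) := by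
  have hev : ∀ᶠ q : ℝ in 𝓝[>] 0, 0 < q ∧ q < 1 := Ioo_mem_nhdsGT one_pos
  have hid : Tendsto (fun q : ℝ ↦ q) (𝓝[>] 0) (𝓝 0) := tendsto_id.mono_left nhdsWithin_le_nhds
  have hT : Tendsto (fun q ↦ T q / q) (𝓝[>] 0) (𝓝 1) := by
    have hu : Tendsto (fun q : ℝ ↦ 1 / (1 - q) ^ 2) (𝓝[>] 0) (𝓝 1) := by
      simpa using ((hid.const_sub 1).pow 2).inv₀ (by norm_num)
    refine tendsto_of_tendsto_of_tendsto_of_le_of_le' tendsto_const_nhds hu ?_ ?_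
    · filter_upwards [hev] with q hq
      exact (one_le_div hq.1).2 (T_bounds hq.1 hq.2).1
    · filter_upwards [hev] with q hq
      rw [div_le_iff₀ hq.1]
      exact (T_bounds hq.1 hq.2).2.trans_eq (by ring)
  have hlog : Tendsto (fun q : ℝ ↦ Real.log (1 - q) / q) (𝓝[>] 0) (𝓝 (-1)) := by
    have hd : HasDerivAt (fun q : ℝ ↦ Real.log (1 - q)) (-1) 0 := by
      simpa using ((hasDerivAt_id (0 : ℝ)).const_sub 1).log (by simp)
    refine (hd.tendsto_slope.mono_left (nhdsGT_le_nhdsNE 0)).congr fun q ↦ ?_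
    simp [slope_def_field]
  have hinv : Tendsto (fun q : ℝ ↦ (Real.log q)⁻¹) (𝓝[>] 0) (𝓝 0) :=
    tendsto_inv_atBot_zero.comp Real.tendsto_log_nhdsGT_zero
  have h := (hid.const_sub 1).mul (hT.sub (hlog.mul hinv))
  simp only [sub_zero, mul_zero, mul_one] at h
  refine h.congr fun q ↦ ?_
  rw [F]
  ring

/-- The terms of the expansion
`-log q * (T q - log (1 - q) / log q) = ∑ k, gammaTerm q k`, which tend to those of
`γ = ∑ k, (1 / (k + 1) - log ((k + 2) / (k + 1)))` as `q → 1`. -/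
noncomputable def gammaTerm (q : ℝ) (k : ℕ) : ℝ :=
  -Real.log q * (q ^ (k + 1) / (1 - q ^ (k + 1))) -
    (Real.log (1 - q ^ (k + 2)) - Real.log (1 - q ^ (k + 1)))

lemma one_sub_pow_pos {q : ℝ} (h0 : 0 < q) (h1 : q < 1) (k : ℕ) : 0 < 1 - q ^ (k + 1) :=
  sub_pos.2 (pow_lt_one₀ h0.le h1 k.succ_ne_zero)

lemma hasSum_gammaTerm {q : ℝ} (h0 : 0 < q) (h1 : q < 1) :
    HasSum (gammaTerm q) (-Real.log q * (T q - Real.log (1 - q) / Real.log q)) := by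
  have htel : HasSum (fun k : ℕ ↦ Real.log (1 - q ^ (k + 2)) - Real.log (1 - q ^ (k + 1)))
      (-Real.log (1 - q)) := by
    rw [hasSum_iff_tendsto_nat_of_nonneg]
    · simp_rw [Finset.sum_range_sub (fun k ↦ Real.log (1 - q ^ (k + 1)))]
      have hpow := (tendsto_pow_atTop_nhds_zero_of_lt_one h0.le h1).comp (tendsto_add_atTop_nat 1)
      simpa using ((hpow.const_sub 1).log (by simp)).sub_const (Real.log (1 - q))
    · intro k
      refine sub_nonneg.2 (Real.log_le_log (one_sub_pow_pos h0 h1 k) ?_)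
      exact sub_le_sub_left (pow_le_pow_of_le_one h0.le h1.le (by lia)) 1
  rw [mul_sub, neg_mul (Real.log q) (_ / _), mul_div_cancel₀ _ (Real.log_neg h0 h1).ne]
  exact ((hasSum_T h0 h1).mul_left (-Real.log q)).sub htel

lemma mul_div_one_sub_sq_le {y : ℝ} (h0 : 0 < y) (h1 : y < 1) :
    y / (1 - y) ^ 2 ≤ 1 / Real.log y ^ 2 := by
  obtain ⟨x, rfl⟩ : ∃ x, Real.exp (-(2 * x)) = y := ⟨-Real.log y / 2, by
    rw [show -(2 * (-Real.log y / 2)) = Real.log y by ring, Real.exp_log h0]⟩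
  have hx : 0 < x := by
    have := Real.exp_lt_one_iff.1 h1
    linarith
  have hsinh := Real.self_le_sinh_iff.2 hx.le
  rw [Real.sinh_eq] at hsinh
  have hE : Real.exp (-(2 * x)) = Real.exp (-x) ^ 2 := by
    rw [← Real.exp_nat_mul]; congr 1; push_cast; ring
  have hmul : Real.exp x * Real.exp (-x) = 1 := by rw [← Real.exp_add]; simp
  have hpos := Real.exp_pos (-x)
  have hkey : 2 * x * Real.exp (-x) ≤ 1 - Real.exp (-(2 * x)) := by
    rw [hE]; nlinarith
  rw [div_le_div_iff₀ (by nlinarith) (by rw [Real.log_exp, neg_sq]; positivity), Real.log_exp]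
  calc Real.exp (-(2 * x)) * (-(2 * x)) ^ 2 = (2 * x * Real.exp (-x)) ^ 2 := by rw [hE]; ring
    _ ≤ (1 - Real.exp (-(2 * x))) ^ 2 := by gcongr
    _ = _ := by ring

lemma norm_gammaTerm_le {q : ℝ} (h0 : 0 < q) (h1 : q < 1) (k : ℕ) :
    ‖gammaTerm q k‖ ≤ 2 / ((k : ℝ) + 1) ^ 2 := by
  set t := -Real.log q with ht
  have htpos : 0 < t := neg_pos.2 (Real.log_neg h0 h1)
  have hqt : 1 - q ≤ t := by linarith [Real.log_le_sub_one_of_pos h0]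
  have htq : t - (1 - q) ≤ t ^ 2 := by
    have h : 1 + t ≤ q⁻¹ := by
      have := Real.add_one_le_exp t
      rwa [ht, Real.exp_neg, Real.exp_log h0, add_comm] at this
    have h' : q * (1 + t) ≤ 1 := by
      rw [mul_comm]; exact (le_div_iff₀ h0).1 (by simpa using h)
    nlinarith
  set y := q ^ (k + 1) with hy
  have hy0 : 0 < y := by positivity
  have hy1 : 0 < 1 - y := one_sub_pow_pos h0 h1 k
  have hz1 : 0 < 1 - q * y := by nlinarith
  have hsq : y / (1 - y) ^ 2 ≤ 1 / ((k + 1) * t) ^ 2 := by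
    refine (mul_div_one_sub_sq_le hy0 (by linarith)).trans_eq ?_
    rw [hy, Real.log_pow]; push_cast; rw [ht]; ring
  have hterm : gammaTerm q k = t * (y / (1 - y)) - Real.log ((1 - q * y) / (1 - y)) := by
    rw [gammaTerm, Real.log_div hz1.ne' hy1.ne', hy, ht, ← pow_succ']
  have hup : Real.log ((1 - q * y) / (1 - y)) ≤ (1 - q) * (y / (1 - y)) := by
    refine (Real.log_le_sub_one_of_pos (by positivity)).trans_eq ?_
    field_simp; ring
  have hlow : (1 - q) * (y / (1 - q * y)) ≤ Real.log ((1 - q * y) / (1 - y)) := by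
    refine Eq.trans_le ?_ (Real.one_sub_inv_le_log_of_pos (by positivity))
    rw [inv_div, one_sub_div hz1.ne']
    ring
  have hfrac : 0 ≤ y / (1 - y) := by positivity
  have hle1 : y / (1 - y) ≤ y / (1 - y) ^ 2 :=
    div_le_div_of_nonneg_left hy0.le (by positivity) (by nlinarith)
  have hle2 : y / (1 - y) - y / (1 - q * y) ≤ (1 - q) * (y / (1 - y) ^ 2) := by
    have : y / (1 - y) - y / (1 - q * y) = (1 - q) * (y * (y / ((1 - y) * (1 - q * y)))) := by
      rw [div_sub_div _ _ hy1.ne' hz1.ne']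
      ring
    rw [this]
    refine mul_le_mul_of_nonneg_left ?_ (by linarith)
    calc y * (y / ((1 - y) * (1 - q * y))) ≤ 1 * (y / ((1 - y) * (1 - y))) := by
          gcongr
          · linarith
          · nlinarith
      _ = _ := by ring
  rw [Real.norm_of_nonneg (by rw [hterm]; nlinarith), hterm]
  calc t * (y / (1 - y)) - Real.log ((1 - q * y) / (1 - y))
      ≤ (t - (1 - q)) * (y / (1 - y)) + (1 - q) * (y / (1 - y) - y / (1 - q * y)) := by linarith
    _ ≤ t ^ 2 * (y / (1 - y) ^ 2) + t * (t * (y / (1 - y) ^ 2)) := by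
        have h2 : y / (1 - y) - y / (1 - q * y) ≤ t * (y / (1 - y) ^ 2) :=
          hle2.trans (by gcongr)
        have h3 : (1 - q) * (y / (1 - y) - y / (1 - q * y)) ≤ (1 - q) * (t * (y / (1 - y) ^ 2)) :=
          mul_le_mul_of_nonneg_left h2 (by linarith)
        have h4 : (1 - q) * (t * (y / (1 - y) ^ 2)) ≤ t * (t * (y / (1 - y) ^ 2)) := by gcongr
        exact add_le_add (mul_le_mul htq hle1 hfrac (by positivity)) (h3.trans h4)
    _ = 2 * t ^ 2 * (y / (1 - y) ^ 2) := by ring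
    _ ≤ 2 * t ^ 2 * (1 / ((k + 1) * t) ^ 2) := by gcongr
    _ = 2 / ((k : ℝ) + 1) ^ 2 := by field_simp

lemma tendsto_neg_log_div_one_sub :
    Tendsto (fun q : ℝ ↦ -Real.log q / (1 - q)) (𝓝[<] 1) (𝓝 1) := by
  have hd := Real.hasDerivAt_log (one_ne_zero (α := ℝ))
  rw [inv_one] at hd
  refine (hd.tendsto_slope.mono_left (nhdsLT_le_nhdsNE 1)).congr fun q ↦ ?_
  rw [slope_def_field, Real.log_one, sub_zero, ← neg_sub 1 q, div_neg, neg_div]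

lemma tendsto_gammaTerm (k : ℕ) :
    Tendsto (fun q ↦ gammaTerm q k) (𝓝[<] 1)
      (𝓝 (1 / ((k : ℝ) + 1) - (Real.log ((k + 1 : ℕ) + 1) - Real.log ((k : ℝ) + 1)))) := by
  have hev : ∀ᶠ q : ℝ in 𝓝[<] 1, 0 < q ∧ q < 1 := Ioo_mem_nhdsLT one_pos
  have hgeom (n : ℕ) :
      Tendsto (fun q : ℝ ↦ ∑ i ∈ Finset.range n, q ^ i) (𝓝[<] 1) (𝓝 n) := by
    have hc : Continuous fun q : ℝ ↦ ∑ i ∈ Finset.range n, q ^ i := by fun_prop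
    simpa using (hc.tendsto 1).mono_left nhdsWithin_le_nhds
  have hpow : Tendsto (fun q : ℝ ↦ q ^ (k + 1)) (𝓝[<] 1) (𝓝 1) := by
    simpa using ((continuous_pow (k + 1)).tendsto (1 : ℝ)).mono_left nhdsWithin_le_nhds
  have h := (tendsto_neg_log_div_one_sub.mul (hpow.div (hgeom (k + 1)) (by positivity))).sub
    (((hgeom (k + 2)).log (by positivity)).sub ((hgeom (k + 1)).log (by positivity)))
  have hlim : (1 : ℝ) * (1 / ((k + 1 : ℕ) : ℝ)) -
      (Real.log ((k + 2 : ℕ) : ℝ) - Real.log ((k + 1 : ℕ) : ℝ)) =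
      1 / ((k : ℝ) + 1) - (Real.log ((k + 1 : ℕ) + 1) - Real.log ((k : ℝ) + 1)) := by
    push_cast
    ring_nf
  rw [hlim] at h
  refine h.congr' ?_
  filter_upwards [hev] with q ⟨h0, h1⟩
  have hq : 0 < 1 - q := sub_pos.2 h1
  have hpos (n : ℕ) : 0 < ∑ i ∈ Finset.range (n + 1), q ^ i :=
    Finset.sum_pos (fun i _ ↦ by positivity) (by simp)
  rw [gammaTerm, ← mul_neg_geom_sum q (k + 2), ← mul_neg_geom_sum q (k + 1),
    Real.log_mul hq.ne' (hpos _).ne', Real.log_mul hq.ne' (hpos _).ne']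
  have := (hpos k).ne'
  simp only [Pi.div_apply]
  field_simp
  ring

lemma hasSum_eulerMascheroniConstant :
    HasSum (fun k : ℕ ↦ 1 / ((k : ℝ) + 1) -
      (Real.log ((k + 1 : ℕ) + 1) - Real.log ((k : ℝ) + 1))) Real.eulerMascheroniConstant := by
  rw [hasSum_iff_tendsto_nat_of_nonneg]
  · refine Real.tendsto_eulerMascheroniSeq.congr fun n ↦ ?_
    rw [Finset.sum_sub_distrib, Finset.sum_range_sub (fun k : ℕ ↦ Real.log ((k : ℝ) + 1))]
    simp [Real.eulerMascheroniSeq, harmonic]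
  · intro k
    rw [← Real.log_div (by positivity) (by positivity), sub_nonneg]
    refine (Real.log_le_sub_one_of_pos (by positivity)).trans_eq ?_
    push_cast
    field_simp
    ring

lemma tendsto_F_one : Tendsto F (𝓝[<] 1) (𝓝 Real.eulerMascheroniConstant) := by
  have hev : ∀ᶠ q : ℝ in 𝓝[<] 1, 0 < q ∧ q < 1 := Ioo_mem_nhdsLT one_pos
  have hbound : Summable fun k : ℕ ↦ 2 / ((k : ℝ) + 1) ^ 2 := by
    have := (summable_nat_add_iff 1).2 (Real.summable_one_div_nat_pow.2 one_lt_two)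
    simpa [div_eq_mul_inv] using this.mul_left 2
  have hsum : Tendsto (fun q ↦ ∑' k, gammaTerm q k) (𝓝[<] 1)
      (𝓝 Real.eulerMascheroniConstant) := by
    rw [← hasSum_eulerMascheroniConstant.tsum_eq]
    refine tendsto_tsum_of_dominated_convergence hbound tendsto_gammaTerm ?_
    filter_upwards [hev] with q hq using norm_gammaTerm_le hq.1 hq.2
  have hid : Tendsto (fun q : ℝ ↦ q) (𝓝[<] 1) (𝓝 1) := tendsto_id.mono_left nhdsWithin_le_nhds
  have h := ((hid.mul tendsto_neg_log_div_one_sub).inv₀ (by simp)).mul hsum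
  simp only [mul_one, inv_one, one_mul] at h
  refine h.congr' ?_
  filter_upwards [hev] with q ⟨h0, h1⟩
  have hlog := (Real.log_neg h0 h1).ne
  have hq : 1 - q ≠ 0 := (sub_pos.2 h1).ne'
  rw [(hasSum_gammaTerm h0 h1).tsum_eq, F]
  field_simp

/-- `F(q) → 1` as `q → 0⁺` and `F(q) → γ` as `q → 1⁻`. -/
theorem F_limits :
    Filter.Tendsto F (nhdsWithin 0 (Set.Ioi (0 : ℝ))) (nhds 1) ∧
      Filter.Tendsto F (nhdsWithin 1 (Set.Iio (1 : ℝ)))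
        (nhds Real.eulerMascheroniConstant) := by
  exact ⟨tendsto_F_zero, tendsto_F_one⟩
end

section
/- For all real numbers q ∈ (0,1), (γ − 1) + (1−q)log(1−q)/(q·log(q)) < ∑_{k=1}^∞ (d(k+1) − d(k)) q^k < 0 + (1−q)log(1−q)/(q·log(q)), where γ is the Euler–Mascheroni constant. -/
open Filter Topology

/-- The hyperbolic sine is convex on the nonnegative half-line. -/
lemma Real.convexOn_sinh : ConvexOn ℝ (Set.Ici 0) Real.sinh := by
  refine MonotoneOn.convexOn_of_deriv (convex_Ici 0) Real.continuous_sinh.continuousOn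
    Real.differentiable_sinh.differentiableOn ?_
  rw [Real.deriv_sinh, interior_Ici]
  exact Real.cosh_strictMonoOn.monotoneOn.mono Set.Ioi_subset_Ici_self

lemma Real.sinh_div_self_monotoneOn : MonotoneOn (fun x => Real.sinh x / x) (Set.Ioi 0) := by
  intro x hx y hy hxy
  simp only [Set.mem_Ioi] at hx hy
  have h := Real.convexOn_sinh.secant_mono (a := 0) (x := x) (y := y) (by simp) hx.le hy.le
    hx.ne' hy.ne' hxy
  simpa using h

/-- The Bose–Einstein weight `1 / (exp (t x) - 1)`. -/
noncomputable def boseWeight (t x : ℝ) : ℝ := (Real.exp (t * x) - 1)⁻¹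

lemma exp_mul_sub_one_pos {t x : ℝ} (ht : 0 < t) (hx : 0 < x) : 0 < Real.exp (t * x) - 1 := by
  have := Real.add_one_lt_exp (mul_pos ht hx).ne'
  have := mul_pos ht hx
  linarith

lemma boseWeight_pos {t x : ℝ} (ht : 0 < t) (hx : 0 < x) : 0 < boseWeight t x :=
  inv_pos.2 (exp_mul_sub_one_pos ht hx)

lemma boseWeight_lt_boseWeight {t x y : ℝ} (ht : 0 < t) (hx : 0 < x) (hxy : x < y) :
    boseWeight t y < boseWeight t x := by
  refine inv_strictAnti₀ (exp_mul_sub_one_pos ht hx) ?_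
  gcongr

lemma hasDerivAt_boseWeight_inv {t y : ℝ} (ht : 0 < t) (hy : 0 < y) :
    HasDerivAt (fun y => boseWeight t y⁻¹)
      (t⁻¹ * ((Real.sinh (t / 2 * y⁻¹) / (t / 2 * y⁻¹)) ^ 2)⁻¹) y := by
  have h0 := exp_mul_sub_one_pos ht (inv_pos.2 hy)
  have h := ((((hasDerivAt_inv hy.ne').const_mul t).exp).sub_const 1).fun_inv h0.ne'
  refine h.congr_deriv ?_
  have hs : Real.sinh (t / 2 * y⁻¹) =
      (Real.exp (t * y⁻¹) - 1) / (2 * Real.exp (t / 2 * y⁻¹)) := by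
    rw [Real.sinh_eq, Real.exp_neg,
      show t * y⁻¹ = t / 2 * y⁻¹ + t / 2 * y⁻¹ by ring, Real.exp_add]
    field_simp
  have he : Real.exp (t * y⁻¹) = Real.exp (t / 2 * y⁻¹) ^ 2 := by
    rw [← Real.exp_nat_mul]; congr 1; push_cast; ring
  rw [hs]
  generalize Real.exp (t * y⁻¹) = E at *
  generalize Real.exp (t / 2 * y⁻¹) = e at *
  subst he
  by_cases he : e = 0
  · simp [he]
  field_simp

lemma convexOn_boseWeight_inv {t : ℝ} (ht : 0 < t) :
    ConvexOn ℝ (Set.Ioi 0) (fun y => boseWeight t y⁻¹) := by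
  have hd := fun y (hy : y ∈ Set.Ioi (0 : ℝ)) => hasDerivAt_boseWeight_inv ht hy
  refine MonotoneOn.convexOn_of_deriv (convex_Ioi 0)
    (fun y hy => (hd y hy).continuousAt.continuousWithinAt) ?_ ?_ <;> rw [interior_Ioi]
  · exact fun y hy => (hd y hy).differentiableAt.differentiableWithinAt
  · intro x hx y hy hxy
    rw [(hd x hx).deriv, (hd y hy).deriv]
    simp only [Set.mem_Ioi] at hx hy
    have hy' : 0 < t / 2 * y⁻¹ := by positivity
    have hx' : 0 < t / 2 * x⁻¹ := by positivity
    have := Real.sinh_pos_iff.2 hy'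
    have hm : Real.sinh (t / 2 * y⁻¹) / (t / 2 * y⁻¹) ≤
        Real.sinh (t / 2 * x⁻¹) / (t / 2 * x⁻¹) :=
      Real.sinh_div_self_monotoneOn hy' hx' (by gcongr)
    gcongr

/-- On `[a, a + 1]`, the weight lies below the chord taken in the variable `1 / x`. -/
lemma boseWeight_le_chord {t a x : ℝ} (ht : 0 < t) (ha : 0 < a) (hax : a ≤ x) (hxa : x ≤ a + 1) :
    boseWeight t x ≤ a * (a + 1) * ((a⁻¹ - x⁻¹) * boseWeight t (a + 1) +
      (x⁻¹ - (a + 1)⁻¹) * boseWeight t a) := by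
  have hx : 0 < x := ha.trans_le hax
  have h := (convexOn_boseWeight_inv ht).2
    (Set.mem_Ioi.2 (by positivity : 0 < (a + 1)⁻¹)) (Set.mem_Ioi.2 (by positivity : 0 < a⁻¹))
    (mul_nonneg (by positivity) (sub_nonneg.2 (by gcongr)) : 0 ≤ a * (a + 1) * (a⁻¹ - x⁻¹))
    (mul_nonneg (by positivity) (sub_nonneg.2 (by gcongr)) :
      0 ≤ a * (a + 1) * (x⁻¹ - (a + 1)⁻¹))
    (by field_simp; ring)
  have e : a * (a + 1) * (a⁻¹ - x⁻¹) * (a + 1)⁻¹ +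
      a * (a + 1) * (x⁻¹ - (a + 1)⁻¹) * a⁻¹ = x⁻¹ := by
    field_simp
    ring
  simp only [smul_eq_mul, inv_inv, e] at h
  linarith

lemma one_sub_exp_neg_pos {t x : ℝ} (ht : 0 < t) (hx : 0 < x) : 0 < 1 - Real.exp (-(t * x)) := by
  have := Real.exp_lt_one_iff.2 (neg_lt_zero.2 (mul_pos ht hx))
  linarith

lemma hasDerivAt_log_one_sub_exp_neg {t x : ℝ} (ht : 0 < t) (hx : 0 < x) :
    HasDerivAt (fun x => Real.log (1 - Real.exp (-(t * x))) / t) (boseWeight t x) x := by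
  have h0 := one_sub_exp_neg_pos ht hx
  have h1 := exp_mul_sub_one_pos ht hx
  have h := (((((hasDerivAt_id x).const_mul t).fun_neg).exp.const_sub 1).log h0.ne').div_const t
  refine h.congr_deriv ?_
  simp only [id, boseWeight, Real.exp_neg] at h0 ⊢
  have := Real.exp_pos (t * x)
  field_simp

/-- The slope coefficient `a (a + 1) log (1 + 1 / a) - a` of the chord estimate. -/
noncomputable def chordCoeff (a : ℝ) : ℝ := a * (a + 1) * (Real.log (a + 1) - Real.log a) - a

lemma log_one_sub_exp_neg_sub_le {t a : ℝ} (ht : 0 < t) (ha : 0 < a) :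
    (Real.log (1 - Real.exp (-(t * (a + 1)))) - Real.log (1 - Real.exp (-(t * a)))) / t ≤
      (1 - chordCoeff a) * boseWeight t (a + 1) + chordCoeff a * boseWeight t a := by
  set Φ : ℝ → ℝ := fun x => a * (a + 1) * ((a⁻¹ * x - Real.log x) * boseWeight t (a + 1) +
      (Real.log x - (a + 1)⁻¹ * x) * boseWeight t a) - Real.log (1 - Real.exp (-(t * x))) / t
    with hΦ
  have hd : ∀ x, 0 < x → HasDerivAt Φ (a * (a + 1) * ((a⁻¹ - x⁻¹) * boseWeight t (a + 1) +
      (x⁻¹ - (a + 1)⁻¹) * boseWeight t a) - boseWeight t x) x := by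
    intro x hx
    have hl := Real.hasDerivAt_log hx.ne'
    have hi := hasDerivAt_id x
    have := (((((hi.const_mul a⁻¹).sub hl).mul_const (boseWeight t (a + 1))).add
      ((hl.sub (hi.const_mul (a + 1)⁻¹)).mul_const (boseWeight t a))).const_mul
        (a * (a + 1))).sub (hasDerivAt_log_one_sub_exp_neg ht hx)
    exact this.congr_deriv (by simp)
  have hm : MonotoneOn Φ (Set.Icc a (a + 1)) := by
    refine monotoneOn_of_deriv_nonneg (convex_Icc _ _)
      (fun x hx => (hd x (ha.trans_le hx.1)).continuousAt.continuousWithinAt) ?_ ?_ <;>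
      rw [interior_Icc]
    · exact fun x hx => (hd x (ha.trans hx.1)).differentiableAt.differentiableWithinAt
    · intro x hx
      rw [(hd x (ha.trans hx.1)).deriv, sub_nonneg]
      exact boseWeight_le_chord ht ha hx.1.le hx.2.le
  have h := hm (Set.left_mem_Icc.2 (by linarith)) (Set.right_mem_Icc.2 (by linarith))
    (by linarith : a ≤ a + 1)
  have e1 : a * (a + 1) * ((a⁻¹ * (a + 1) - Real.log (a + 1)) - (a⁻¹ * a - Real.log a)) =
      1 - chordCoeff a := by
    unfold chordCoeff
    field_simp
    ring
  have e2 : a * (a + 1) * ((Real.log (a + 1) - (a + 1)⁻¹ * (a + 1)) -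
      (Real.log a - (a + 1)⁻¹ * a)) = chordCoeff a := by
    unfold chordCoeff
    field_simp
    ring
  rw [sub_div, ← e1, ← e2]
  simp only [hΦ] at h
  linarith

lemma boseWeight_lt_log_one_sub_exp_neg_sub {t a : ℝ} (ht : 0 < t) (ha : 0 < a) :
    boseWeight t (a + 1) <
      (Real.log (1 - Real.exp (-(t * (a + 1)))) - Real.log (1 - Real.exp (-(t * a)))) / t := by
  have h0 := one_sub_exp_neg_pos ht ha
  have h1 := one_sub_exp_neg_pos ht (by linarith : 0 < a + 1)
  rw [lt_div_iff₀ ht, ← Real.log_div h1.ne' h0.ne']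
  refine lt_of_lt_of_le ?_ (Real.one_sub_inv_le_log_of_pos (div_pos h1 h0))
  have hb : boseWeight t (a + 1) = Real.exp (-(t * (a + 1))) / (1 - Real.exp (-(t * (a + 1)))) := by
    unfold boseWeight
    have := exp_mul_sub_one_pos ht (by linarith : 0 < a + 1)
    rw [Real.exp_neg] at h1 ⊢
    field_simp
  have ht1 : t + 1 < Real.exp t := Real.add_one_lt_exp ht.ne'
  have he : Real.exp (-(t * a)) = Real.exp t * Real.exp (-(t * (a + 1))) := by
    rw [← Real.exp_add]; congr 1; ring
  have hp := Real.exp_pos (-(t * (a + 1)))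
  rw [hb, inv_div, one_sub_div h1.ne', div_mul_eq_mul_div, div_lt_div_iff_of_pos_right h1, he]
  nlinarith

lemma chordCoeff_strictMonoOn : StrictMonoOn chordCoeff (Set.Ioi 0) := by
  have hd : ∀ x : ℝ, 0 < x → HasDerivAt chordCoeff
      ((2 * x + 1) * (Real.log (x + 1) - Real.log x) - 2) x := by
    intro x hx
    have hi := hasDerivAt_id x
    have := ((hi.mul (hi.add_const 1)).mul
      (((hi.add_const 1).log (by simp only [id]; positivity)).sub
        (Real.hasDerivAt_log hx.ne'))).sub hi
    refine this.congr_deriv ?_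
    simp only [id, Pi.mul_apply]
    field_simp
    simp
    ring
  refine strictMonoOn_of_deriv_pos (convex_Ioi 0)
    (fun x hx => (hd x hx).continuousAt.continuousWithinAt) ?_
  rw [interior_Ioi]
  intro x hx
  rw [(hd x hx).deriv]
  simp only [Set.mem_Ioi] at hx
  have h := Real.lt_log_one_add_of_pos (inv_pos.2 hx)
  rw [show 1 + x⁻¹ = (x + 1) / x by field_simp, Real.log_div (by positivity) hx.ne',
    show 2 * x⁻¹ / (x⁻¹ + 2) = 2 / (2 * x + 1) by field_simp; ring, div_lt_iff₀ (by positivity)] at h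
  linarith

lemma chordCoeff_le_one {a : ℝ} (ha : 0 < a) : chordCoeff a ≤ 1 := by
  have h := Real.log_le_sub_one_of_pos (by positivity : 0 < (a + 1) / a)
  rw [Real.log_div (by positivity) ha.ne', show (a + 1) / a - 1 = a⁻¹ by field_simp; ring] at h
  have h2 := mul_le_mul_of_nonneg_left h (by positivity : 0 ≤ a * (a + 1))
  rw [show a * (a + 1) * a⁻¹ = a + 1 by field_simp] at h2
  unfold chordCoeff
  linarith

/-- Strict Chebyshev-type estimate obtained from summation by parts. -/
lemma sum_mul_sub_ge_of_antitone {w D : ℕ → ℝ} (hw : Antitone w) (hD : ∀ n, 0 ≤ D n)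
    (hD0 : D 0 = 0) (N : ℕ) :
    w (N + 1) * D (N + 2) + (w 0 - w 1) * D 1 ≤
      ∑ n ∈ Finset.range (N + 2), w n * (D (n + 1) - D n) := by
  induction N with
  | zero =>
    simp only [Finset.sum_range_succ, Finset.sum_range_zero, hD0]
    ring_nf
    rfl
  | succ N ih =>
    rw [Finset.sum_range_succ]
    have := mul_nonneg (sub_nonneg.2 (hw (Nat.le_succ (N + 1)))) (hD (N + 2))
    simp only [Nat.succ_eq_add_one, add_assoc, Nat.reduceAdd] at *
    linarith

/-- The difference between the weight at `n + 1` and its integral over `[n + 1, n + 2]`. -/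
noncomputable def boseGap (t : ℝ) (n : ℕ) : ℝ :=
  boseWeight t (n + 1) -
    (Real.log (1 - Real.exp (-(t * ((n + 1 : ℝ) + 1)))) -
      Real.log (1 - Real.exp (-(t * (n + 1))))) / t

lemma boseGap_lt {t : ℝ} (ht : 0 < t) (n : ℕ) :
    boseGap t n < boseWeight t (n + 1) - boseWeight t (n + 1 + 1) :=
  sub_lt_sub_left (boseWeight_lt_log_one_sub_exp_neg_sub ht (by positivity)) _

lemma le_boseGap {t : ℝ} (ht : 0 < t) (n : ℕ) :
    (1 - chordCoeff (n + 1)) * (boseWeight t (n + 1) - boseWeight t (n + 1 + 1)) ≤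
      boseGap t n := by
  have := log_one_sub_exp_neg_sub_le ht (by positivity : (0 : ℝ) < n + 1)
  unfold boseGap
  linarith

lemma sum_boseGap_le {t : ℝ} (ht : 0 < t) (N : ℕ) :
    ∑ n ∈ Finset.range (N + 1), boseGap t n ≤ boseGap t 0 + boseWeight t 2 := by
  have h : ∑ n ∈ Finset.range N, boseGap t (n + 1) ≤
      boseWeight t 2 - boseWeight t (N + 2) := by
    have ht := Finset.sum_le_sum fun n (_ : n ∈ Finset.range N) => (boseGap_lt ht (n + 1)).le
    have he := Finset.sum_range_sub' (fun n : ℕ => boseWeight t (n + 2)) N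
    refine ht.trans (le_of_eq ?_)
    rw [Nat.cast_zero, zero_add] at he
    rw [← he]
    refine Finset.sum_congr rfl fun n _ => ?_
    push_cast
    ring_nf
  have := boseWeight_pos ht (by positivity : (0 : ℝ) < N + 2)
  rw [Finset.sum_range_succ']
  linarith

lemma sum_chordCoeff (N : ℕ) :
    ∑ n ∈ Finset.range N, (1 - chordCoeff (n + 1)) * ((n + 1 : ℝ)⁻¹ - (n + 1 + 1 : ℝ)⁻¹) =
      Real.eulerMascheroniSeq N := by
  induction N with
  | zero => simp [Real.eulerMascheroniSeq_zero]
  | succ N ih =>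
    rw [Finset.sum_range_succ, ih, Real.eulerMascheroniSeq, Real.eulerMascheroniSeq, harmonic_succ,
      chordCoeff]
    push_cast
    field_simp
    ring

lemma le_sum_boseGap {t : ℝ} (ht : 0 < t) :
    ∃ δ > 0, ∀ N : ℕ, Real.eulerMascheroniSeq (N + 2) + δ ≤
      (Real.exp t - 1) * ∑ n ∈ Finset.range (N + 2), boseGap t n := by
  set E := Real.exp t - 1 with hE
  have hE0 : 0 < E := by simpa only [mul_one] using exp_mul_sub_one_pos ht one_pos
  set D : ℕ → ℝ := fun n => (n + 1 : ℝ)⁻¹ - E * boseWeight t (n + 1) with hD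
  set w : ℕ → ℝ := fun n => 1 - chordCoeff (n + 1) with hw
  have hexp : ∀ n : ℕ, Real.exp (t * (n + 1)) = (1 + E) ^ (n + 1) := fun n => by
    rw [hE, add_sub_cancel, ← Real.exp_nat_mul]
    congr 1
    push_cast
    ring
  have hpos : ∀ n : ℕ, 0 < (1 + E) ^ (n + 1) - 1 := fun n => by
    rw [← hexp]
    exact exp_mul_sub_one_pos ht (by positivity)
  have hD0 : D 0 = 0 := by
    have := hpos 0
    simp only [hD, boseWeight, hexp]
    simp [hE0.ne']
  have hDnn : ∀ n, 0 ≤ D n := fun n => by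
    have h := one_add_mul_le_pow (by linarith : -2 ≤ E) (n + 1)
    push_cast at h
    simp only [hD, boseWeight, hexp]
    rw [sub_nonneg, ← div_eq_mul_inv, div_le_iff₀ (hpos n), inv_mul_eq_div,
      le_div_iff₀ (by positivity)]
    linarith
  have hD1 : 0 < D 1 := by
    simp only [hD, boseWeight, hexp]
    rw [sub_pos, ← div_eq_mul_inv, div_lt_iff₀ (hpos 1)]
    norm_num
    nlinarith
  have hwanti : StrictAnti w := fun m n hmn => sub_lt_sub_left
    (chordCoeff_strictMonoOn (Set.mem_Ioi.2 (by positivity)) (Set.mem_Ioi.2 (by positivity))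
      (by gcongr)) _
  refine ⟨(w 0 - w 1) * D 1, mul_pos (sub_pos.2 (hwanti one_pos)) hD1, fun N => ?_⟩
  have h1 := sum_mul_sub_ge_of_antitone hwanti.antitone hDnn hD0 N
  have h2 : 0 ≤ w (N + 1) * D (N + 2) :=
    mul_nonneg (sub_nonneg.2 (chordCoeff_le_one (by positivity))) (hDnn _)
  calc Real.eulerMascheroniSeq (N + 2) + (w 0 - w 1) * D 1
      ≤ Real.eulerMascheroniSeq (N + 2) +
          ∑ n ∈ Finset.range (N + 2), w n * (D (n + 1) - D n) := by linarith
    _ = ∑ n ∈ Finset.range (N + 2),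
          E * (w n * (boseWeight t (n + 1) - boseWeight t (n + 1 + 1))) := by
        rw [← sum_chordCoeff, ← Finset.sum_add_distrib]
        refine Finset.sum_congr rfl fun n _ => ?_
        simp only [hw, hD]
        push_cast
        ring
    _ ≤ E * ∑ n ∈ Finset.range (N + 2), boseGap t n := by
        rw [Finset.mul_sum]
        gcongr with n
        exact le_boseGap ht n

lemma sum_boseGap (t : ℝ) (N : ℕ) :
    ∑ n ∈ Finset.range N, boseGap t n = ∑ n ∈ Finset.range N, boseWeight t (n + 1) -
      (Real.log (1 - Real.exp (-(t * (N + 1)))) - Real.log (1 - Real.exp (-t))) / t := by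
  have h := Finset.sum_range_sub (fun n : ℕ => Real.log (1 - Real.exp (-(t * (n + 1))))) N
  simp only [Nat.cast_zero, zero_add, mul_one] at h
  rw [← h, Finset.sum_div, ← Finset.sum_sub_distrib]
  refine Finset.sum_congr rfl fun n _ => ?_
  rw [boseGap]
  push_cast
  rfl

lemma tendsto_sum_boseGap {t S : ℝ} (ht : 0 < t)
    (hS : HasSum (fun n : ℕ => boseWeight t (n + 1)) S) :
    Tendsto (fun N => ∑ n ∈ Finset.range N, boseGap t n) atTop
      (𝓝 (S + Real.log (1 - Real.exp (-t)) / t)) := by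
  have hu : Tendsto (fun N : ℕ => t * ((N : ℝ) + 1)) atTop atTop :=
    (tendsto_atTop_add_const_right _ _ tendsto_natCast_atTop_atTop).const_mul_atTop ht
  have hl : Tendsto (fun N : ℕ => Real.log (1 - Real.exp (-(t * (N + 1))))) atTop (𝓝 0) := by
    have := ((Real.tendsto_exp_neg_atTop_nhds_zero.comp hu).const_sub 1).log (by simp)
    simpa using this
  simp only [sum_boseGap]
  convert hS.tendsto_sum_nat.sub ((hl.sub_const (Real.log (1 - Real.exp (-t)))).div_const t) using 2
  ring

/-- The Lambert series `∑ 1 / (exp (n t) - 1)`, corrected by its logarithmic part, lies strictly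
between `γ / (exp t - 1)` and `1 / (exp t - 1)`. -/
lemma eulerMascheroniConstant_lt_and_lt_one {t S : ℝ} (ht : 0 < t)
    (hS : HasSum (fun n : ℕ => boseWeight t (n + 1)) S) :
    Real.eulerMascheroniConstant < (Real.exp t - 1) * (S + Real.log (1 - Real.exp (-t)) / t) ∧
      (Real.exp t - 1) * (S + Real.log (1 - Real.exp (-t)) / t) < 1 := by
  have hlim := tendsto_sum_boseGap ht hS
  have hE0 : 0 < Real.exp t - 1 := by simpa only [mul_one] using exp_mul_sub_one_pos ht one_pos
  constructor
  · obtain ⟨δ, hδ, h⟩ := le_sum_boseGap ht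
    have := le_of_tendsto_of_tendsto'
      (((tendsto_add_atTop_iff_nat 2).2 Real.tendsto_eulerMascheroniSeq).add_const δ)
      (((tendsto_add_atTop_iff_nat 2).2 hlim).const_mul (Real.exp t - 1)) h
    linarith
  · have h1 := le_of_tendsto' ((tendsto_add_atTop_iff_nat 1).2 hlim) (sum_boseGap_le ht)
    have h2 := boseGap_lt ht 0
    norm_num at h2
    have h3 : S + Real.log (1 - Real.exp (-t)) / t < boseWeight t 1 := by linarith
    have h4 := mul_lt_mul_of_pos_left h3 hE0
    rwa [boseWeight, mul_one, mul_inv_cancel₀ hE0.ne'] at h4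

lemma summable_numDivisors_mul_pow {q : ℝ} (hq0 : 0 < q) (hq1 : q < 1) :
    Summable fun n : ℕ => (numDivisors n : ℝ) * q ^ n := by
  have h := summable_norm_pow_mul_geometric_of_norm_lt_one (R := ℝ) 1
    (by rwa [Real.norm_of_nonneg hq0.le] : ‖q‖ < 1)
  refine Summable.of_nonneg_of_le (fun n => by positivity) (fun n => ?_) h
  rw [pow_one, Real.norm_of_nonneg (by positivity)]
  gcongr
  exact Nat.card_divisors_le_self n

lemma hasSum_lambert {q : ℝ} (hq0 : 0 < q) (hq1 : q < 1) :
    HasSum (fun n : ℕ => q ^ (n + 1) / (1 - q ^ (n + 1)))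
      (∑' n : ℕ, (numDivisors (n + 1) : ℝ) * q ^ (n + 1)) := by
  have hq : ‖q‖ < 1 := by rwa [Real.norm_of_nonneg hq0.le]
  have h := tsum_pow_div_one_sub_eq_tsum_sigma hq 0
  rw [tsum_pnat_eq_tsum_succ (f := fun n : ℕ => (n : ℝ) ^ 0 * q ^ n / (1 - q ^ n)),
    tsum_pnat_eq_tsum_succ (f := fun n : ℕ => (ArithmeticFunction.sigma 0 n : ℝ) * q ^ n)] at h
  simp only [pow_zero, one_mul, ArithmeticFunction.sigma_zero_apply] at h
  simp only [numDivisors]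
  rw [← h]
  have hs : Summable fun n : ℕ => q ^ n / (1 - q ^ n) := by
    simpa only [pow_zero, one_mul] using summable_norm_pow_mul_geometric_div_one_sub 0 hq
  exact ((summable_nat_add_iff 1).2 hs).hasSum

lemma tsum_numDivisors_sub {q : ℝ} (hq0 : 0 < q) (hq1 : q < 1) :
    ∑' n : ℕ, ((numDivisors (n + 2) : ℝ) - (numDivisors (n + 1) : ℝ)) * q ^ (n + 1) =
      (1 - q) / q * (∑' n : ℕ, (numDivisors (n + 1) : ℝ) * q ^ (n + 1)) - 1 := by
  have hs := (summable_nat_add_iff 1).2 (summable_numDivisors_mul_pow hq0 hq1)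
  have hs2 := (summable_nat_add_iff 1).2 hs
  have h0 := hs.tsum_eq_zero_add
  have h1 : ∀ n : ℕ, ((numDivisors (n + 2) : ℝ) - numDivisors (n + 1)) * q ^ (n + 1) =
      q⁻¹ * (numDivisors (n + 1 + 1) * q ^ (n + 1 + 1)) - numDivisors (n + 1) * q ^ (n + 1) := by
    intro n
    rw [pow_succ q (n + 1)]
    field_simp
  have hd : numDivisors 1 = 1 := by simp [numDivisors]
  rw [tsum_congr h1, (hs2.mul_left q⁻¹).tsum_sub hs, tsum_mul_left]
  simp only [zero_add, hd, Nat.cast_one, pow_one, one_mul] at h0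
  field_simp
  linarith

/-- For `q ∈ (0,1)`:
`(γ - 1) + (1-q)log(1-q)/(q log q) < ∑_{k=1}^∞ (d(k+1) - d(k)) q^k
  < 0 + (1-q)log(1-q)/(q log q)`.
The series is indexed by `k = n + 1`, `n : ℕ`. -/
theorem divisor_difference_series_bounds (q : ℝ) (hq : q ∈ Set.Ioo (0 : ℝ) 1) :
    (Real.eulerMascheroniConstant - 1) + (1 - q) * Real.log (1 - q) / (q * Real.log q) <
        (∑' n : ℕ, ((numDivisors (n + 2) : ℝ) - (numDivisors (n + 1) : ℝ)) * q ^ (n + 1)) ∧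
      (∑' n : ℕ, ((numDivisors (n + 2) : ℝ) - (numDivisors (n + 1) : ℝ)) * q ^ (n + 1)) <
        0 + (1 - q) * Real.log (1 - q) / (q * Real.log q) := by
  obtain ⟨hq0, hq1⟩ := hq
  have ht : 0 < -Real.log q := neg_pos.2 (Real.log_neg hq0 hq1)
  have hS := hasSum_lambert hq0 hq1
  have hb : ∀ n : ℕ, q ^ (n + 1) / (1 - q ^ (n + 1)) = boseWeight (-Real.log q) (n + 1) := by
    intro n
    have he : Real.exp (-Real.log q * (n + 1)) = (q ^ (n + 1))⁻¹ := by
      rw [← Real.exp_log (pow_pos hq0 (n + 1)), Real.log_pow, ← Real.exp_neg]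
      congr 1
      push_cast
      ring
    have h1 : q ^ (n + 1) < 1 := pow_lt_one₀ hq0.le hq1 n.succ_ne_zero
    have h2 : 1 - q ^ (n + 1) ≠ 0 := (sub_pos.2 h1).ne'
    rw [boseWeight, he]
    field_simp
  rw [funext hb] at hS
  have hE : Real.exp (-Real.log q) - 1 = (1 - q) / q := by
    rw [Real.exp_neg, Real.exp_log hq0]
    field_simp
  have h := eulerMascheroniConstant_lt_and_lt_one ht hS
  rw [hE, neg_neg, Real.exp_log hq0, mul_add] at h
  have hl : (1 - q) / q * (Real.log (1 - q) / -Real.log q) =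
      -((1 - q) * Real.log (1 - q) / (q * Real.log q)) := by
    rw [div_mul_div_comm, mul_neg, div_neg]
  rw [tsum_numDivisors_sub hq0 hq1]
  rw [hl] at h
  constructor <;> linarith [h.1, h.2]
end

section
/- For each fixed real number x ≥ 1, the function q ↦ φ_q(x) = q^x(q^x − qx + x − 1)/(1−q^x)² is increasing (monotone nondecreasing) on the interval (0,1). -/
/-- `φ_q(x) = q^x (q^x - qx + x - 1) / (1 - q^x)²`, with `q^x` the real power. -/
noncomputable def phi (q x : ℝ) : ℝ := q ^ x * (q ^ x - q * x + x - 1) / (1 - q ^ x) ^ 2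

/-- Bernoulli's inequality at `1 / q`, multiplied by `q ^ x`. -/
lemma rpow_add_mul_rpow_sub_le_one {x q : ℝ} (hx : 1 ≤ x) (hq : 0 < q) :
    q ^ x + x * (q ^ (x - 1) - q ^ x) ≤ 1 := by
  have h := one_add_mul_self_le_rpow_one_add (s := q⁻¹ - 1) (by linarith [inv_pos.2 hq]) hx
  rw [add_sub_cancel, Real.inv_rpow hq.le] at h
  have hu : 0 < q ^ x := Real.rpow_pos_of_pos hq x
  have h' := mul_le_mul_of_nonneg_left h hu.le
  rw [mul_inv_cancel₀ hu.ne'] at h'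
  rw [Real.rpow_sub_one hq.ne', div_eq_mul_inv]
  linarith

/-- With `q = exp (-2 * t)`, this says `tanh (x * t) ≤ x * tanh t`. -/
lemma one_add_mul_one_sub_rpow_le {x q : ℝ} (hx : 1 ≤ x) (hq : 0 < q) (hq1 : q ≤ 1) :
    (1 + q) * (1 - q ^ x) ≤ x * (1 - q) * (1 + q ^ x) := by
  have hd : ∀ p ∈ Set.Ioi (0 : ℝ),
      HasDerivAt (fun p : ℝ => x * (1 - p) * (1 + p ^ x) - (1 + p) * (1 - p ^ x))
        ((x + 1) * (p ^ x + x * (p ^ (x - 1) - p ^ x) - 1)) p := by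
    intro p hp
    have hp0 : p ≠ 0 := ne_of_gt hp
    have hu := Real.hasDerivAt_rpow_const (x := p) (p := x) (Or.inl hp0)
    have h := ((((hasDerivAt_id p).const_sub 1).const_mul x).mul (hu.const_add 1)).sub
      (((hasDerivAt_id p).const_add 1).mul (hu.const_sub 1))
    refine h.congr_deriv ?_
    simp only [id, Real.rpow_sub_one hp0]
    field_simp
    ring
  have hanti : AntitoneOn (fun p : ℝ => x * (1 - p) * (1 + p ^ x) - (1 + p) * (1 - p ^ x))
      (Set.Ioi 0) := by
    refine antitoneOn_of_deriv_nonpos (convex_Ioi 0)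
      (fun p hp => (hd p hp).continuousAt.continuousWithinAt) ?_ ?_
    · rw [interior_Ioi]
      exact fun p hp => (hd p hp).differentiableAt.differentiableWithinAt
    · rw [interior_Ioi]
      intro p hp
      rw [(hd p hp).deriv]
      exact mul_nonpos_of_nonneg_of_nonpos (by linarith)
        (by linarith [rpow_add_mul_rpow_sub_le_one hx hp])
  have h := hanti (Set.mem_Ioi.2 hq) (Set.mem_Ioi.2 one_pos) hq1
  simp only [Real.one_rpow, sub_self, mul_zero, zero_mul] at h
  linarith

lemma hasDerivAt_phi {x q : ℝ} (hq : 0 < q) (hu : q ^ x ≠ 1) :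
    HasDerivAt (fun q : ℝ => phi q x)
      (x * q ^ x / q * (x * (1 - q) * (1 + q ^ x) - (1 + q) * (1 - q ^ x)) / (1 - q ^ x) ^ 3) q := by
  have h1 : 1 - q ^ x ≠ 0 := sub_ne_zero.2 hu.symm
  have hd := Real.hasDerivAt_rpow_const (x := q) (p := x) (Or.inl hq.ne')
  have h := (hd.mul (((hd.sub ((hasDerivAt_id q).mul_const x)).add_const x).sub_const 1)).div
    ((hd.const_sub 1).pow 2) (pow_ne_zero 2 h1)
  refine h.congr_deriv ?_
  simp only [id, Pi.sub_apply, Pi.mul_apply, Pi.pow_apply, Real.rpow_sub_one hq.ne']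
  generalize q ^ x = u at *
  field_simp
  ring

/-- For fixed `x ≥ 1`, the map `q ↦ φ_q(x)` is monotone nondecreasing on `(0,1)`. -/
theorem phi_monotone_in_q (x : ℝ) (hx : 1 ≤ x) :
    MonotoneOn (fun q : ℝ => phi q x) (Set.Ioo (0 : ℝ) 1) := by
  have hlt : ∀ q ∈ Set.Ioo (0 : ℝ) 1, q ^ x < 1 := fun q hq =>
    Real.rpow_lt_one hq.1.le hq.2 (by linarith)
  have hd := fun q (hq : q ∈ Set.Ioo (0 : ℝ) 1) => hasDerivAt_phi hq.1 (hlt q hq).ne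
  refine monotoneOn_of_deriv_nonneg (convex_Ioo 0 1)
    (fun q hq => (hd q hq).continuousAt.continuousWithinAt) ?_ ?_
  · rw [interior_Ioo]
    exact fun q hq => (hd q hq).differentiableAt.differentiableWithinAt
  · rw [interior_Ioo]
    intro q hq
    rw [(hd q hq).deriv]
    have hq0 := hq.1
    have h1 : 0 < 1 - q ^ x := sub_pos.2 (hlt q hq)
    have h2 := sub_nonneg.2 (one_add_mul_one_sub_rpow_le hx hq.1 hq.2.le)
    positivity
end

section
/- For each q ∈ (0,1) there exist real numbers M_q and N_q with 1 < M_q < N_q such that the function x ↦ φ_q(x) is strictly concave on [1, N_q], strictly convex on [N_q, ∞), strictly increasing on [1, M_q], and strictly decreasing on [M_q, ∞). -/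
open Real Set

/-- The function `t ↦ t (cosh t + c) / sinh t`. For `c = 1` and `c = 2` it governs the signs of
the first and second derivatives of `phiScaled`. -/
noncomputable def cothLike (c t : ℝ) : ℝ := t * (cosh t + c) / sinh t

/-- The function `φ_q` in the variable `t = -x log q`, where `k = (1 - q) / (-log q)`. -/
noncomputable def phiScaled (k t : ℝ) : ℝ := k * t / (2 * (cosh t - 1)) - 1 / (exp t - 1)

/-- The derivative of `phiScaled`. -/
noncomputable def phiScaledDeriv (k t : ℝ) : ℝ :=
  (1 + k) / (2 * (cosh t - 1)) - k * t * sinh t / (2 * (cosh t - 1) ^ 2)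

lemma cosh_sub_one_pos {t : ℝ} (ht : 0 < t) : 0 < cosh t - 1 :=
  sub_pos.2 (one_lt_cosh.2 ht.ne')

lemma two_mul_cosh_sub_one_mul_exp (t : ℝ) : 2 * (cosh t - 1) * exp t = (exp t - 1) ^ 2 := by
  have h : exp (-t) * exp t = 1 := by rw [← exp_add]; simp
  rw [cosh_eq]
  linear_combination h

lemma hasDerivAt_cothLike (c : ℝ) {t : ℝ} (ht : 0 < t) :
    HasDerivAt (cothLike c)
      ((sinh t * cosh t + c * sinh t - t - c * t * cosh t) / sinh t ^ 2) t := by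
  have hs : sinh t ≠ 0 := (sinh_pos_iff.2 ht).ne'
  refine (((hasDerivAt_id t).mul ((hasDerivAt_cosh t).add_const c)).div
    (hasDerivAt_sinh t) hs).congr_deriv ?_
  have h := cosh_sq t
  congr 1
  simp only [id, Pi.mul_apply]
  linear_combination -t * h

lemma strictMonoOn_cothLike {c : ℝ}
    (h : ∀ t, 0 < t → 0 < sinh t * cosh t + c * sinh t - t - c * t * cosh t) :
    StrictMonoOn (cothLike c) (Ioi 0) := by
  refine strictMonoOn_of_deriv_pos (convex_Ioi 0)
    (fun t ht => (hasDerivAt_cothLike c ht).continuousAt.continuousWithinAt) fun t ht => ?_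
  rw [interior_Ioi] at ht
  rw [(hasDerivAt_cothLike c ht).deriv]
  exact div_pos (h t ht) (pow_pos (sinh_pos_iff.2 ht) 2)

lemma strictMonoOn_cothLike_one : StrictMonoOn (cothLike 1) (Ioi 0) := by
  refine strictMonoOn_cothLike fun t ht => ?_
  have h := mul_pos (sub_pos.2 (self_lt_sinh_iff.2 ht))
    (add_pos (cosh_pos t) one_pos)
  linarith

lemma strictMonoOn_cothLike_two : StrictMonoOn (cothLike 2) (Ioi 0) := by
  refine strictMonoOn_cothLike fun t ht => ?_
  have hd (s : ℝ) : HasDerivAt (fun t => sinh t * cosh t + 2 * sinh t - t - 2 * t * cosh t)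
      (2 * sinh s * (sinh s - s)) s := by
    refine (((((hasDerivAt_sinh s).mul (hasDerivAt_cosh s)).add
      ((hasDerivAt_sinh s).const_mul 2)).sub (hasDerivAt_id s)).sub
      (((hasDerivAt_id s).const_mul 2).mul (hasDerivAt_cosh s))).congr_deriv ?_
    simp only [id]
    linear_combination cosh_sq s
  have hmono : StrictMonoOn (fun t => sinh t * cosh t + 2 * sinh t - t - 2 * t * cosh t)
      (Ici 0) := by
    refine strictMonoOn_of_deriv_pos (convex_Ici 0)
      (fun s _ => (hd s).continuousAt.continuousWithinAt) fun s hs => ?_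
    rw [interior_Ici] at hs
    rw [(hd s).deriv]
    exact mul_pos (mul_pos two_pos (sinh_pos_iff.2 hs)) (sub_pos.2 (self_lt_sinh_iff.2 hs))
  simpa using hmono self_mem_Ici ht.le ht

lemma exists_cothLike_eq {c a r : ℝ} (hc : 0 ≤ c) (ha : 0 < a) (hr : cothLike c a < r) :
    ∃ t, a < t ∧ cothLike c t = r := by
  have hb : 0 < max a r := lt_max_of_lt_left ha
  have hrb : r ≤ cothLike c (max a r) := by
    have hs := sinh_pos_iff.2 hb
    refine (le_max_right a r).trans ?_
    rw [cothLike, le_div_iff₀ hs]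
    exact mul_le_mul_of_nonneg_left (by linarith [sinh_lt_cosh (max a r)]) hb.le
  obtain ⟨t, ht, hrt⟩ := intermediate_value_Icc (le_max_left a r)
    (fun t ht => (hasDerivAt_cothLike c (ha.trans_le ht.1)).continuousAt.continuousWithinAt)
    ⟨hr.le, hrb⟩
  refine ⟨t, ht.1.lt_of_ne ?_, hrt⟩
  rintro rfl
  exact hr.ne hrt

lemma cothLike_two_lt {t : ℝ} (ht : 0 < t) : cothLike 2 t < cothLike 1 t + 1 := by
  have hs := sinh_pos_iff.2 ht
  have h : t / sinh t < 1 := (div_lt_one hs).2 (self_lt_sinh_iff.2 ht)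
  have : cothLike 2 t = cothLike 1 t + t / sinh t := by
    rw [cothLike, cothLike]; ring
  linarith

lemma hasDerivAt_phiScaled (k : ℝ) {t : ℝ} (ht : 0 < t) :
    HasDerivAt (phiScaled k) (phiScaledDeriv k t) t := by
  have hC := (cosh_sub_one_pos ht).ne'
  have hE : exp t - 1 ≠ 0 := (sub_pos.2 (one_lt_exp_iff.2 ht)).ne'
  refine ((((hasDerivAt_id t).const_mul k).div
    (((hasDerivAt_cosh t).sub_const 1).const_mul 2) (mul_ne_zero two_ne_zero hC)).sub
    ((hasDerivAt_const t (1 : ℝ)).div ((hasDerivAt_exp t).sub_const 1) hE)).congr_deriv ?_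
  have h : exp t / (exp t - 1) ^ 2 = 1 / (2 * (cosh t - 1)) := by
    rw [← two_mul_cosh_sub_one_mul_exp]
    field_simp
  simp only [id, phiScaledDeriv, zero_mul, zero_sub, one_mul, neg_div, sub_neg_eq_add, h]
  field_simp
  ring

lemma hasDerivAt_phiScaledDeriv (k : ℝ) {t : ℝ} (ht : 0 < t) :
    HasDerivAt (phiScaledDeriv k)
      ((k * t * (cosh t + 2) - (1 + 2 * k) * sinh t) / (2 * (cosh t - 1) ^ 2)) t := by
  have hC := (cosh_sub_one_pos ht).ne'
  refine (((hasDerivAt_const t (1 + k)).div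
    (((hasDerivAt_cosh t).sub_const 1).const_mul 2) (mul_ne_zero two_ne_zero hC)).sub
    ((((hasDerivAt_id t).const_mul k).mul (hasDerivAt_sinh t)).div
    ((((hasDerivAt_cosh t).sub_const 1).pow 2).const_mul 2)
    (mul_ne_zero two_ne_zero (pow_ne_zero 2 hC)))).congr_deriv ?_
  simp only [id, Pi.mul_apply, Pi.pow_apply]
  field_simp
  have h := cosh_sq t
  push_cast
  linear_combination (2 * k * t * (1 - cosh t)) * h

lemma phiScaledDeriv_eq {k t : ℝ} (hk : 0 < k) (ht : 0 < t) :
    phiScaledDeriv k t = k / (2 * (cosh t - 1)) * (1 + 1 / k - cothLike 1 t) := by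
  have hC := (cosh_sub_one_pos ht).ne'
  have hs := (sinh_pos_iff.2 ht).ne'
  rw [phiScaledDeriv, cothLike]
  field_simp
  linear_combination (k * t) * cosh_sq t

lemma phiScaledDeriv_pos {k s t : ℝ} (hk : 0 < k) (hs : 0 < s) (hst : s < t)
    (ht : cothLike 1 t = 1 + 1 / k) : 0 < phiScaledDeriv k s := by
  rw [phiScaledDeriv_eq hk hs]
  have := cosh_sub_one_pos hs
  have := strictMonoOn_cothLike_one hs (hs.trans hst) hst
  exact mul_pos (by positivity) (by linarith)

lemma phiScaledDeriv_neg {k s t : ℝ} (hk : 0 < k) (hs : 0 < s) (hst : s < t)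
    (hs' : cothLike 1 s = 1 + 1 / k) : phiScaledDeriv k t < 0 := by
  rw [phiScaledDeriv_eq hk (hs.trans hst)]
  have := cosh_sub_one_pos (hs.trans hst)
  have := strictMonoOn_cothLike_one hs (hs.trans hst) hst
  exact mul_neg_of_pos_of_neg (by positivity) (by linarith)

lemma deriv_phiScaledDeriv_eq {k t : ℝ} (hk : 0 < k) (ht : 0 < t) :
    deriv (phiScaledDeriv k) t =
      k * sinh t / (2 * (cosh t - 1) ^ 2) * (cothLike 2 t - (2 + 1 / k)) := by
  have hC := (cosh_sub_one_pos ht).ne'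
  have hs := (sinh_pos_iff.2 ht).ne'
  rw [(hasDerivAt_phiScaledDeriv k ht).deriv, cothLike]
  field_simp
  ring

lemma strictAntiOn_phiScaledDeriv {k T : ℝ} (hk : 0 < k) (hT : cothLike 2 T = 2 + 1 / k) :
    StrictAntiOn (phiScaledDeriv k) (Ioc 0 T) := by
  refine strictAntiOn_of_deriv_neg (convex_Ioc 0 T)
    (fun t ht => (hasDerivAt_phiScaledDeriv k ht.1).continuousAt.continuousWithinAt)
    fun t ht => ?_
  rw [interior_Ioc] at ht
  have h0 : 0 < t := ht.1
  rw [deriv_phiScaledDeriv_eq hk h0]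
  have := cosh_sub_one_pos h0
  have := sinh_pos_iff.2 h0
  have := strictMonoOn_cothLike_two h0 (h0.trans ht.2) ht.2
  exact mul_neg_of_pos_of_neg (by positivity) (by linarith)

lemma strictMonoOn_phiScaledDeriv {k T : ℝ} (hk : 0 < k) (hT0 : 0 < T)
    (hT : cothLike 2 T = 2 + 1 / k) : StrictMonoOn (phiScaledDeriv k) (Ici T) := by
  refine strictMonoOn_of_deriv_pos (convex_Ici T)
    (fun t ht => (hasDerivAt_phiScaledDeriv k
      (hT0.trans_le ht)).continuousAt.continuousWithinAt) fun t ht => ?_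
  rw [interior_Ici] at ht
  have h0 : 0 < t := hT0.trans ht
  rw [deriv_phiScaledDeriv_eq hk h0]
  have := cosh_sub_one_pos h0
  have := sinh_pos_iff.2 h0
  have := strictMonoOn_cothLike_two hT0 h0 ht
  exact mul_pos (by positivity) (by linarith)

lemma phi_eq_phiScaled {q x : ℝ} (hq : q ∈ Ioo (0 : ℝ) 1) (hx : 0 < x) :
    phi q x = phiScaled ((1 - q) / -log q) (-log q * x) := by
  have ha : 0 < -log q := neg_pos.2 (log_neg hq.1 hq.2)
  have ht : 0 < -log q * x := mul_pos ha hx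
  have hkt : (1 - q) / -log q * (-log q * x) = (1 - q) * x := by
    rw [← mul_assoc, div_mul_cancel₀ _ ha.ne']
  have hqx : q ^ x = (exp (-log q * x))⁻¹ := by
    rw [rpow_def_of_pos hq.1, ← exp_neg]; ring_nf
  have hE : exp (-log q * x) - 1 ≠ 0 := (sub_pos.2 (one_lt_exp_iff.2 ht)).ne'
  have hC : 2 * (cosh (-log q * x) - 1) =
      (exp (-log q * x) - 1) ^ 2 / exp (-log q * x) := by
    rw [← two_mul_cosh_sub_one_mul_exp, mul_div_cancel_right₀ _ (exp_pos _).ne']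
  rw [phi, phiScaled, hkt, hC, hqx]
  have hE0 := (exp_pos (-log q * x)).ne'
  generalize exp (-log q * x) = E at hE hE0 ⊢
  have hinv : 1 - E⁻¹ = (E - 1) / E := by
    field_simp
  rw [hinv]
  field_simp
  ring

lemma hasDerivAt_phi_s10 {q x : ℝ} (hq : q ∈ Ioo (0 : ℝ) 1) (hx : 0 < x) :
    HasDerivAt (phi q) (phiScaledDeriv ((1 - q) / -log q) (-log q * x) * -log q) x := by
  have ha : 0 < -log q := neg_pos.2 (log_neg hq.1 hq.2)
  have h := (hasDerivAt_phiScaled ((1 - q) / -log q) (mul_pos ha hx)).comp x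
    ((hasDerivAt_id x).const_mul (-log q))
  rw [mul_one] at h
  refine h.congr_of_eventuallyEq ?_
  filter_upwards [Ioi_mem_nhds hx] with y hy using phi_eq_phiScaled hq hy

lemma cothLike_one_lt {a : ℝ} (ha : 0 < a) :
    cothLike 1 a < 1 + 1 / ((1 - exp (-a)) / a) := by
  have hs := sinh_pos_iff.2 ha
  have hu : 0 < 1 - exp (-a) := sub_pos.2 (exp_lt_one_iff.2 (neg_neg_iff_pos.2 ha))
  have hprod : exp (-a) * exp a = 1 := by rw [← exp_add]; simp
  have hlt : a * exp (-a) < 1 - exp (-a) := by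
    nlinarith [add_one_lt_exp ha.ne', exp_pos (-a)]
  have hcoth : cothLike 1 a = a * (1 + exp (-a)) / (1 - exp (-a)) := by
    rw [cothLike, div_eq_div_iff hs.ne' hu.ne', cosh_eq, sinh_eq]
    linear_combination (-a) * hprod
  rw [hcoth, one_div_div, ← sub_pos]
  have : 1 + a / (1 - exp (-a)) - a * (1 + exp (-a)) / (1 - exp (-a)) =
      (1 - exp (-a) - a * exp (-a)) / (1 - exp (-a)) := by
    field_simp
    ring
  rw [this]
  exact div_pos (by linarith) hu

/-- For each `q ∈ (0,1)` there are `1 < M < N` such that `φ_q` is strictly concave on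
`[1, N]`, strictly convex on `[N, ∞)`, strictly increasing on `[1, M]` and strictly
decreasing on `[M, ∞)`. -/
theorem phi_shape (q : ℝ) (hq : q ∈ Set.Ioo (0 : ℝ) 1) :
    ∃ M N : ℝ, 1 < M ∧ M < N ∧
      StrictConcaveOn ℝ (Set.Icc (1 : ℝ) N) (phi q) ∧
      StrictConvexOn ℝ (Set.Ici N) (phi q) ∧
      StrictMonoOn (phi q) (Set.Icc (1 : ℝ) M) ∧
      StrictAntiOn (phi q) (Set.Ici M) := by
  have ha : 0 < -log q := neg_pos.2 (log_neg hq.1 hq.2)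
  have hk : 0 < (1 - q) / -log q := div_pos (sub_pos.2 hq.2) ha
  have hderiv {x : ℝ} (hx : 0 < x) := (hasDerivAt_phi_s10 hq hx).deriv
  have hcont {s : Set ℝ} (hs : s ⊆ Ioi 0) : ContinuousOn (phi q) s :=
    fun x hx => (hasDerivAt_phi_s10 hq (hs hx)).continuousAt.continuousWithinAt
  have hstart := cothLike_one_lt ha
  rw [neg_neg, exp_log hq.1] at hstart
  obtain ⟨S, haS, hS⟩ := exists_cothLike_eq zero_le_one ha hstart
  have hS0 : 0 < S := ha.trans haS
  obtain ⟨T, hST, hT⟩ := exists_cothLike_eq (r := 2 + 1 / ((1 - q) / -log q)) zero_le_two hS0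
    (by linarith [cothLike_two_lt hS0])
  have hT0 : 0 < T := hS0.trans hST
  have hM : 1 < S / -log q := (one_lt_div ha).2 haS
  have hMN : S / -log q < T / -log q := div_lt_div_of_pos_right hST ha
  have hM0 : 0 < S / -log q := one_pos.trans hM
  have hN0 : 0 < T / -log q := hM0.trans hMN
  refine ⟨S / -log q, T / -log q, hM, hMN, ?_, ?_, ?_, ?_⟩
  · refine StrictAntiOn.strictConcaveOn_of_deriv (convex_Icc _ _)
      (hcont fun x hx => one_pos.trans_le hx.1) ?_
    rw [interior_Icc]
    intro x hx y hy hxy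
    have hx0 : 0 < x := one_pos.trans hx.1
    have hy0 : 0 < y := one_pos.trans hy.1
    rw [hderiv hx0, hderiv hy0]
    exact mul_lt_mul_of_pos_right (strictAntiOn_phiScaledDeriv hk hT
      ⟨mul_pos ha hx0, ((lt_div_iff₀' ha).1 hx.2).le⟩
      ⟨mul_pos ha hy0, ((lt_div_iff₀' ha).1 hy.2).le⟩ (mul_lt_mul_of_pos_left hxy ha)) ha
  · refine StrictMonoOn.strictConvexOn_of_deriv (convex_Ici _)
      (hcont fun x hx => hN0.trans_le hx) ?_
    rw [interior_Ici]
    intro x hx y hy hxy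
    rw [hderiv (hN0.trans hx), hderiv (hN0.trans hy)]
    exact mul_lt_mul_of_pos_right (strictMonoOn_phiScaledDeriv hk hT0 hT
      ((div_lt_iff₀' ha).1 hx).le ((div_lt_iff₀' ha).1 hy).le
      (mul_lt_mul_of_pos_left hxy ha)) ha
  · refine strictMonoOn_of_deriv_pos (convex_Icc _ _)
      (hcont fun x hx => one_pos.trans_le hx.1) fun x hx => ?_
    rw [interior_Icc] at hx
    have hx0 : 0 < x := one_pos.trans hx.1
    rw [hderiv hx0]
    exact mul_pos (phiScaledDeriv_pos hk (mul_pos ha hx0) ((lt_div_iff₀' ha).1 hx.2) hS) ha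
  · refine strictAntiOn_of_deriv_neg (convex_Ici _)
      (hcont fun x hx => hM0.trans_le hx) fun x hx => ?_
    rw [interior_Ici] at hx
    rw [hderiv (hM0.trans hx)]
    exact mul_neg_of_neg_of_pos
      (phiScaledDeriv_neg hk hS0 ((div_lt_iff₀' ha).1 hx) hS) ha
end

section
/- For every q ∈ (0, 0.117], one has C_q(1) > 0, i.e. ∫_1^2 φ_q(x) dx − φ_q(2) > 0. -/
/-- For `y ≥ 1`, `log y ≤ √y - 1/√y`. -/
theorem Real.log_le_sqrt_sub_inv_sqrt {y : ℝ} (hy : 1 ≤ y) : Real.log y ≤ √y - (√y)⁻¹ := by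
  have h0 : 0 < √y := Real.sqrt_pos.2 (by linarith)
  have h1 : 0 ≤ Real.log (√y) := Real.log_nonneg (Real.one_le_sqrt.2 hy)
  have h2 := Real.self_le_sinh_iff.2 h1
  rw [Real.sinh_log h0, Real.log_sqrt (by linarith)] at h2
  linarith

/-- An antiderivative of `phi q`. -/
theorem hasDerivAt_phi_antiderivative {q x : ℝ} (hq0 : 0 < q) (hq1 : q < 1) (hx : 0 < x) :
    HasDerivAt (fun x : ℝ => (1 - q) * (x * (q ^ x / (1 - q ^ x)) / Real.log q
      + Real.log (1 - q ^ x) / Real.log q ^ 2) + Real.log (1 - q ^ x) / Real.log q)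
      (phi q x) x := by
  have hu : q ^ x < 1 := Real.rpow_lt_one hq0.le hq1 hx
  have hl : Real.log q ≠ 0 := (Real.log_neg hq0 hq1).ne
  have hne : 1 - q ^ x ≠ 0 := by linarith
  have hd : HasDerivAt (fun x : ℝ => q ^ x) (q ^ x * Real.log q) x := by
    simpa using Real.hasStrictDerivAt_const_rpow hq0 x |>.hasDerivAt
  have hd1 := hd.const_sub 1
  have hlog := hd1.log hne
  have hfrac := (hasDerivAt_id x).mul (hd.div hd1 hne)
  have key := (((hfrac.div_const (Real.log q)).add (hlog.div_const (Real.log q ^ 2))).const_mul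
    (1 - q)).add (hlog.div_const (Real.log q))
  refine key.congr_deriv ?_
  simp only [phi, id, Pi.div_apply]
  field_simp
  ring

theorem integral_phi_one_two {q : ℝ} (hq0 : 0 < q) (hq1 : q < 1) :
    ∫ x in (1 : ℝ)..2, phi q x = -(q * (1 - q) / (1 + q)) / Real.log q
      + (1 - q) * Real.log (1 + q) / Real.log q ^ 2 + Real.log (1 + q) / Real.log q := by
  have hl : Real.log q ≠ 0 := (Real.log_neg hq0 hq1).ne
  have hpos : ∀ x ∈ Set.uIcc (1 : ℝ) 2, 0 < x := fun x hx => by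
    rw [Set.uIcc_of_le (by norm_num)] at hx
    linarith [hx.1]
  have hcont : ContinuousOn (phi q) (Set.uIcc 1 2) := by
    have hc : Continuous fun x : ℝ => q ^ x := Real.continuous_const_rpow hq0.ne'
    unfold phi
    refine ContinuousOn.div (by fun_prop) (by fun_prop) fun x hx => ?_
    have := Real.rpow_lt_one hq0.le hq1 (hpos x hx)
    exact pow_ne_zero _ (by linarith)
  rw [intervalIntegral.integral_eq_sub_of_hasDerivAt
    (fun x hx => hasDerivAt_phi_antiderivative hq0 hq1 (hpos x hx)) hcont.intervalIntegrable]
  have h1 : 1 - q ≠ 0 := by linarith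
  have h2 : 1 + q ≠ 0 := by linarith
  have hfac : 1 - q ^ 2 = (1 - q) * (1 + q) := by ring
  simp only [Real.rpow_one, Real.rpow_two, hfac, Real.log_mul h1 h2]
  field_simp
  ring

/-- For `0 < q ≤ 0.117`, `√q · (-log q)` is at most `√0.117` times a quadratic in `√(q/0.117)`. -/
theorem neg_log_mul_le {t : ℝ} (ht0 : 0 < t) (ht1 : t ≤ 1) :
    t * -Real.log (0.117 * t ^ 2) ≤ 1 + 2.148 * t - t ^ 2 := by
  have hlog : -Real.log 0.117 ≤ 2.148 := by
    have h : (0.117 : ℝ)⁻¹ = 2 ^ 3 * (1 / 0.936) := by norm_num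
    rw [← Real.log_inv, h, Real.log_mul (by norm_num) (by norm_num), Real.log_pow]
    have h1 := Real.log_two_lt_d9
    have h2 := Real.log_le_sub_one_of_pos (show (0 : ℝ) < 1 / 0.936 by norm_num)
    norm_num at h2 ⊢
    linarith
  have hsinh := Real.self_le_sinh_iff.2 (Real.log_nonneg ((one_le_inv₀ ht0).2 ht1))
  rw [Real.sinh_log (inv_pos.2 ht0), Real.log_inv, inv_inv] at hsinh
  rw [Real.log_mul (by norm_num) (by positivity), Real.log_pow]
  push_cast
  have h : -(Real.log 0.117 + 2 * Real.log t) ≤ 2.148 + (t⁻¹ - t) := by linarith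
  calc t * -(Real.log 0.117 + 2 * Real.log t) ≤ t * (2.148 + (t⁻¹ - t)) := by gcongr
    _ = 1 + 2.148 * t - t ^ 2 := by
      field_simp
      ring

theorem log_one_add_le {q : ℝ} (hq0 : 0 < q) :
    Real.log (1 + q) ≤ q * (1 - q / 2 + 3 / 8 * q ^ 2) := by
  have h := Real.log_le_sqrt_sub_inv_sqrt (show 1 ≤ 1 + q by linarith)
  set r := √(1 + q)
  have hr : 0 < r := Real.sqrt_pos.2 (by linarith)
  have hr2 : r ^ 2 = 1 + q := Real.sq_sqrt (by linarith)
  have hs : r - r⁻¹ = q * r⁻¹ := by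
    field_simp
    linarith
  have hp : 0 < 1 - q / 2 + 3 / 8 * q ^ 2 := by nlinarith [sq_nonneg (q - 1)]
  have hinv : r⁻¹ ≤ 1 - q / 2 + 3 / 8 * q ^ 2 := by
    refine (sq_le_sq₀ (inv_pos.2 hr).le hp.le).1 ?_
    rw [inv_pow, hr2, inv_le_iff_one_le_mul₀ (by linarith)]
    nlinarith [pow_pos hq0 3, pow_pos hq0 4, pow_pos hq0 5, mul_nonneg (pow_pos hq0 3).le (sq_nonneg (q - 1))]
  rw [hs] at h
  exact h.trans (by gcongr)

theorem polynomial_bound {t : ℝ} (ht0 : 0 < t) (ht1 : t ≤ 1) :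
    0 < (1 - 0.117 * t ^ 2) * (1 - 0.117 * t ^ 2 / 2) - 3 / 2 * (0.117 * t) * (1 + 2.148 * t - t ^ 2)
      - 0.117 * (1 + 2.148 * t - t ^ 2) ^ 2 * (1 - 2 * (0.117 * t ^ 2) + 3 * (0.117 * t ^ 2) ^ 2) := by
  have h : 0 ≤ 1 - t := by linarith
  have hb (i j : ℕ) : 0 ≤ t ^ i * (1 - t) ^ j := by positivity
  nlinarith [hb 0 8, hb 1 7, hb 2 6, hb 3 5, hb 4 4, hb 5 3, hb 6 2, hb 7 1, hb 8 0]

/-- For `q ∈ (0, 0.117]` we have `C_q(1) = ∫_1^2 φ_q(x) dx - φ_q(2) > 0`. -/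
theorem CQ_one_pos (q : ℝ) (hq : q ∈ Set.Ioc (0 : ℝ) 0.117) :
    0 < (∫ x in (1 : ℝ)..2, phi q x) - phi q 2 := by
  obtain ⟨hq0, hqb⟩ := hq
  have hq1 : q < 1 := by linarith
  have hphi : phi q 2 = q ^ 2 / (1 + q) ^ 2 := by
    have h1 : 1 - q ≠ 0 := by linarith
    have h2 : 1 + q ≠ 0 := by linarith
    have hfac : 1 - q ^ 2 = (1 - q) * (1 + q) := by ring
    simp only [phi, Real.rpow_two, hfac]
    field_simp
    ring
  rw [integral_phi_one_two hq0 hq1, hphi]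
  obtain ⟨t, ht0, ht1, rfl⟩ : ∃ t : ℝ, 0 < t ∧ t ≤ 1 ∧ q = 0.117 * t ^ 2 := by
    refine ⟨√(q / 0.117), Real.sqrt_pos.2 (by positivity), ?_, ?_⟩
    · refine Real.sqrt_le_iff.2 ⟨zero_le_one, ?_⟩
      rw [one_pow, div_le_one (by norm_num)]
      exact hqb
    · rw [Real.sq_sqrt (by positivity)]
      field_simp
  have hpoly := polynomial_bound ht0 ht1
  have hL := neg_log_mul_le ht0 ht1
  set q := 0.117 * t ^ 2 with hqt
  have hup := log_one_add_le hq0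
  have hlow := Real.le_log_one_add_of_nonneg hq0.le
  set l := Real.log (1 + q)
  have hLpos : 0 < -Real.log q := neg_pos.2 (Real.log_neg hq0 hq1)
  set L := -Real.log q with hLdef
  have hlogq : Real.log q = -L := by ring
  rw [hlogq]
  set M := 1 + 2.148 * t - t ^ 2
  have hlow' : q * (1 - q / 2) ≤ l := by
    refine le_trans ?_ hlow
    rw [le_div_iff₀ (by linarith)]
    nlinarith [pow_pos hq0 3]
  have hinv : 1 / (1 + q) ^ 2 ≤ 1 - 2 * q + 3 * q ^ 2 := by
    rw [div_le_iff₀ (by positivity)]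
    nlinarith [pow_pos hq0 3, pow_pos hq0 4]
  have hdiff : l - q * (1 - q) / (1 + q) ≤ 3 / 2 * q ^ 2 := by
    rw [sub_le_iff_le_add, ← sub_le_iff_le_add', le_div_iff₀ (by linarith)]
    nlinarith [mul_le_mul_of_nonneg_right hup (show 0 ≤ 1 + q by linarith), pow_pos hq0 3,
      pow_pos hq0 4, mul_le_mul_of_nonneg_left hqb (pow_pos hq0 3).le]
  have hLL : (t * L) ^ 2 ≤ M ^ 2 := by gcongr
  have hterm1 : (1 - q) * (q * (1 - q / 2)) ≤ (1 - q) * l :=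
    mul_le_mul_of_nonneg_left hlow' (by linarith)
  have hterm2 : L * (l - q * (1 - q) / (1 + q)) ≤ q * (3 / 2 * (0.117 * t) * M) := by
    calc L * (l - q * (1 - q) / (1 + q)) ≤ L * (3 / 2 * q ^ 2) := by gcongr
      _ = q * (3 / 2 * (0.117 * t) * (t * L)) := by rw [hqt]; ring
      _ ≤ q * (3 / 2 * (0.117 * t) * M) := by gcongr
  have hterm3 : L ^ 2 * (q ^ 2 / (1 + q) ^ 2) ≤ q * (0.117 * M ^ 2 * (1 - 2 * q + 3 * q ^ 2)) := by
    calc L ^ 2 * (q ^ 2 / (1 + q) ^ 2) = q * (0.117 * (t * L) ^ 2 * (1 / (1 + q) ^ 2)) := by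
          nth_rewrite 1 [sq q]
          nth_rewrite 2 [hqt]
          ring
      _ ≤ q * (0.117 * M ^ 2 * (1 - 2 * q + 3 * q ^ 2)) := by gcongr
  have hnum : 0 < (1 - q) * l - L * (l - q * (1 - q) / (1 + q)) - L ^ 2 * (q ^ 2 / (1 + q) ^ 2) := by
    have := mul_pos hq0 hpoly
    linarith
  have hfinal : -(q * (1 - q) / (1 + q)) / -L + (1 - q) * l / (-L) ^ 2 + l / -L
      - q ^ 2 / (1 + q) ^ 2
      = ((1 - q) * l - L * (l - q * (1 - q) / (1 + q)) - L ^ 2 * (q ^ 2 / (1 + q) ^ 2)) / L ^ 2 := by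
    field_simp
    ring
  rw [hfinal]
  positivity
end
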